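/- arXiv:2011.14692 — 2 statements merged into one kernel-verified Lean document; each statement's English description precedes it below -/
import Mathlib

section
/- Let S = k[α_0, α_1, α_2] and fix integers e, d, r with C(e+1, 2) < d < r < C(e+2, 2) and r − d ≤ d − s, where s = C(e+1, 2) = dim_k S_{e−1}. Set A_i = α_1^i α_2^{e−i}, B_i = α_1^i α_2^{e+1−i}, C_i = α_1^i α_2^{e+2−i}. Let J = (A_i for d−s ≤ i ≤ e; B_i for r−d ≤ i ≤ d−s−1; C_i for 0 ≤ i ≤ r−d−1) and I = (A_i for r−s ≤ i ≤ e; A_i·α_2 and A_i·α_0 for d−s ≤ i ≤ r−s−1; B_i for r−d ≤ i ≤ d−s−1; C_i for 0 ≤ i ≤ r−d−1). Then dim_k Hom_S(J, S/I)_0 = 2r. -/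
open MvPolynomial

/-- `A_i = α₁^i α₂^(e-i)` where `α₀ = X 0`, `α₁ = X 1`, `α₂ = X 2`. -/
noncomputable def A (k : Type*) [Field k] (e i : ℕ) : MvPolynomial (Fin 3) k :=
  X 1 ^ i * X 2 ^ (e - i)

/-- `B_i = α₁^i α₂^(e+1-i)`. -/
noncomputable def B (k : Type*) [Field k] (e i : ℕ) : MvPolynomial (Fin 3) k :=
  X 1 ^ i * X 2 ^ (e + 1 - i)

/-- `C_i = α₁^i α₂^(e+2-i)`. -/
noncomputable def C (k : Type*) [Field k] (e i : ℕ) : MvPolynomial (Fin 3) k :=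
  X 1 ^ i * X 2 ^ (e + 2 - i)

/-- The ideal `J = (A_i for d-s ≤ i ≤ e; B_i for r-d ≤ i ≤ d-s-1; C_i for 0 ≤ i ≤ r-d-1)`. -/
noncomputable def Jf (k : Type*) [Field k] (e d r s : ℕ) : Ideal (MvPolynomial (Fin 3) k) :=
  Ideal.span (A k e '' Set.Icc (d - s) e ∪ B k e '' Set.Icc (r - d) (d - s - 1) ∪
    C k e '' Set.Iic (r - d - 1))

/-- The ideal `I = (A_i for r-s ≤ i ≤ e; A_i·α₂ and A_i·α₀ for d-s ≤ i ≤ r-s-1;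
B_i for r-d ≤ i ≤ d-s-1; C_i for 0 ≤ i ≤ r-d-1)`. -/
noncomputable def If (k : Type*) [Field k] (e d r s : ℕ) : Ideal (MvPolynomial (Fin 3) k) :=
  Ideal.span (A k e '' Set.Icc (r - s) e ∪
    (fun i => A k e i * X 2) '' Set.Icc (d - s) (r - s - 1) ∪
    (fun i => A k e i * X 0) '' Set.Icc (d - s) (r - s - 1) ∪
    B k e '' Set.Icc (r - d) (d - s - 1) ∪
    C k e '' Set.Iic (r - d - 1))

/-- The degree-`d` graded piece of `S/I`. -/
noncomputable def quotPiece (k : Type*) [Field k]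
    (I : Ideal (MvPolynomial (Fin 3) k)) (d : ℕ) :
    Submodule k (MvPolynomial (Fin 3) k ⧸ I) :=
  (homogeneousSubmodule (Fin 3) k d).map (Ideal.Quotient.mkₐ k I).toLinearMap

/-- The `k`-vector space `Hom_S(J, S/I)₀` of degree-preserving `S`-module homomorphisms. -/
noncomputable def Hom0 (k : Type*) [Field k]
    (J I : Ideal (MvPolynomial (Fin 3) k)) :
    Submodule k ((↥J) →ₗ[MvPolynomial (Fin 3) k] (MvPolynomial (Fin 3) k ⧸ I)) where
  carrier := {φ | ∀ (d : ℕ) (f : ↥J), (f : MvPolynomial (Fin 3) k).IsHomogeneous d →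
    φ f ∈ quotPiece k I d}
  add_mem' := fun h1 h2 d f hf => by
    simpa using Submodule.add_mem _ (h1 d f hf) (h2 d f hf)
  zero_mem' := fun d f hf => by simp
  smul_mem' := fun r φ h d f hf => by
    simpa using Submodule.smul_mem _ r (h d f hf)

namespace HomJ

variable {k : Type*} [Field k]

/-- The exponent of `α₀^a α₁^b α₂^c`. -/
noncomputable def mon (a b c : ℕ) : Fin 3 →₀ ℕ := Finsupp.equivFunOnFinite.symm ![a, b, c]

@[simp] lemma mon_0 (a b c : ℕ) : mon a b c 0 = a := rfl
@[simp] lemma mon_1 (a b c : ℕ) : mon a b c 1 = b := rfl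
@[simp] lemma mon_2 (a b c : ℕ) : mon a b c 2 = c := rfl

lemma ext3 {m n : Fin 3 →₀ ℕ} (h0 : m 0 = n 0) (h1 : m 1 = n 1) (h2 : m 2 = n 2) : m = n := by
  ext i
  fin_cases i <;> assumption

lemma le3 {m n : Fin 3 →₀ ℕ} : m ≤ n ↔ m 0 ≤ n 0 ∧ m 1 ≤ n 1 ∧ m 2 ≤ n 2 := by
  rw [Finsupp.le_def]
  constructor
  · intro h
    exact ⟨h 0, h 1, h 2⟩
  · rintro ⟨h0, h1, h2⟩ i
    fin_cases i <;> assumption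

lemma degree3 (m : Fin 3 →₀ ℕ) : m.degree = m 0 + m 1 + m 2 := by
  rw [Finsupp.degree_eq_sum, Fin.sum_univ_three]

lemma mon_add (a b c a' b' c' : ℕ) :
    mon a b c + mon a' b' c' = mon (a + a') (b + b') (c + c') := by
  apply ext3 <;> simp

/-- The class of a monomial. -/
noncomputable def cl (I : Ideal (MvPolynomial (Fin 3) k)) (m : Fin 3 →₀ ℕ) :
    MvPolynomial (Fin 3) k ⧸ I :=
  Ideal.Quotient.mk I (monomial m 1)

lemma cl_mem (I : Ideal (MvPolynomial (Fin 3) k)) (m : Fin 3 →₀ ℕ) (a : ℕ)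
    (h : m 0 + m 1 + m 2 = a) : cl I m ∈ quotPiece k I a := by
  refine ⟨monomial m 1, ?_, rfl⟩
  rw [SetLike.mem_coe, mem_homogeneousSubmodule]
  apply isHomogeneous_monomial
  rw [degree3, h]

lemma smul_mk (I : Ideal (MvPolynomial (Fin 3) k)) (g f : MvPolynomial (Fin 3) k) :
    g • (Ideal.Quotient.mk I f) = Ideal.Quotient.mk I (g * f) := rfl

lemma ksmul_mk (I : Ideal (MvPolynomial (Fin 3) k)) (c : k) (f : MvPolynomial (Fin 3) k) :
    c • (Ideal.Quotient.mk I f) = Ideal.Quotient.mk I (c • f) := rfl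

lemma smul_ksmul (I : Ideal (MvPolynomial (Fin 3) k)) (g : MvPolynomial (Fin 3) k) (c : k)
    (y : MvPolynomial (Fin 3) k ⧸ I) : g • (c • y) = c • (g • y) := by
  obtain ⟨f, rfl⟩ := Ideal.Quotient.mk_surjective y
  rw [ksmul_mk, smul_mk, smul_mk, ksmul_mk, mul_smul_comm]

lemma smul_cl (I : Ideal (MvPolynomial (Fin 3) k)) (m n : Fin 3 →₀ ℕ) :
    (monomial n (1 : k)) • cl I m = cl I (n + m) := by
  rw [cl, cl, smul_mk, monomial_mul, one_mul]

lemma smul_mem_piece (I : Ideal (MvPolynomial (Fin 3) k)) (n : Fin 3 →₀ ℕ) (a a' : ℕ)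
    (h : a + (n 0 + n 1 + n 2) = a') {y : MvPolynomial (Fin 3) k ⧸ I} (hy : y ∈ quotPiece k I a) :
    (monomial n (1 : k)) • y ∈ quotPiece k I a' := by
  obtain ⟨f, hf, rfl⟩ := hy
  refine ⟨monomial n 1 * f, ?_, ?_⟩
  · rw [SetLike.mem_coe, mem_homogeneousSubmodule] at hf ⊢
    rw [← h, add_comm a, ← degree3]
    exact (isHomogeneous_monomial _ rfl).mul hf
  · rfl

/-- Multiplication by a monomial between graded pieces. -/
noncomputable def mulP (I : Ideal (MvPolynomial (Fin 3) k)) (n : Fin 3 →₀ ℕ) (a a' : ℕ)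
    (h : a + (n 0 + n 1 + n 2) = a') : quotPiece k I a →ₗ[k] quotPiece k I a' where
  toFun y := ⟨(monomial n (1 : k)) • (y : MvPolynomial (Fin 3) k ⧸ I),
    smul_mem_piece I n a a' h y.2⟩
  map_add' x y := by exact Subtype.ext (smul_add _ _ _)
  map_smul' c y := by exact Subtype.ext (smul_ksmul I _ c y)

/-- A monomial is nonzero modulo the monomial ideal `I`. -/
def Nz (I : Ideal (MvPolynomial (Fin 3) k)) (m : Fin 3 →₀ ℕ) : Prop := ∀ f ∈ I, coeff m f = 0

lemma Nz.of_add {I : Ideal (MvPolynomial (Fin 3) k)} {m n : Fin 3 →₀ ℕ} (h : Nz I (n + m)) :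
    Nz I m := by
  intro f hf
  have := h (monomial n 1 * f) (I.mul_mem_left _ hf)
  rwa [coeff_monomial_mul, one_mul] at this

open Classical in
/-- Coefficient functional on the quotient. -/
noncomputable def cf (I : Ideal (MvPolynomial (Fin 3) k)) (m : Fin 3 →₀ ℕ) :
    (MvPolynomial (Fin 3) k ⧸ I) →ₗ[k] k :=
  if h : Nz I m then
    ((I.restrictScalars k).liftQ (lcoeff k m) (by
      intro f hf
      exact h f hf)).comp (Submodule.Quotient.restrictScalarsEquiv k I).symm.toLinearMap
  else 0

lemma cf_mk {I : Ideal (MvPolynomial (Fin 3) k)} {m : Fin 3 →₀ ℕ} (h : Nz I m)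
    (f : MvPolynomial (Fin 3) k) : cf I m (Ideal.Quotient.mk I f) = coeff m f := by
  rw [cf, dif_pos h]
  rfl

lemma cf_cl {I : Ideal (MvPolynomial (Fin 3) k)} {m : Fin 3 →₀ ℕ} (h : Nz I m)
    (n : Fin 3 →₀ ℕ) : cf I m (cl I n) = if n = m then 1 else 0 := by
  classical
  rw [cl, cf_mk h, coeff_monomial]

lemma cf_smul {I : Ideal (MvPolynomial (Fin 3) k)} {m n : Fin 3 →₀ ℕ} (h : Nz I (n + m))
    (y : MvPolynomial (Fin 3) k ⧸ I) : cf I (n + m) ((monomial n (1 : k)) • y) = cf I m y := by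
  obtain ⟨f, rfl⟩ := Ideal.Quotient.mk_surjective y
  rw [smul_mk, cf_mk h, cf_mk h.of_add,
    coeff_monomial_mul, one_mul]

lemma cf_smul_zero {I : Ideal (MvPolynomial (Fin 3) k)} {m n : Fin 3 →₀ ℕ} (h : Nz I m)
    (hn : ¬ n ≤ m)
    (y : MvPolynomial (Fin 3) k ⧸ I) : cf I m ((monomial n (1 : k)) • y) = 0 := by
  obtain ⟨f, rfl⟩ := Ideal.Quotient.mk_surjective y
  rw [smul_mk, cf_mk h,
    coeff_monomial_mul', if_neg hn]

/-! ### Dimension of graded pieces -/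

lemma piece_span (I : Ideal (MvPolynomial (Fin 3) k)) (a e : ℕ) (h : ℕ → ℕ)
    (hz : ∀ m : Fin 3 →₀ ℕ, m 0 + m 1 + m 2 = a → ¬ (m 1 < e ∧ m 2 < h (m 1)) →
      monomial m (1 : k) ∈ I)
    (hd : ∀ i j, i < e → j < h i → i + j ≤ a) :
    Submodule.span k (Set.range (fun x : (Σ i : Fin e, Fin (h i)) =>
      cl I (mon (a - x.1 - x.2) x.1 x.2))) = quotPiece k I a := by
  apply le_antisymm
  · rw [Submodule.span_le]
    rintro _ ⟨⟨i, j⟩, rfl⟩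
    apply cl_mem
    have := hd i j i.2 j.2
    simp only [mon_0, mon_1, mon_2]
    omega
  · rintro _ ⟨f, hf, rfl⟩
    rw [SetLike.mem_coe, mem_homogeneousSubmodule] at hf
    rw [f.as_sum, map_sum]
    apply Submodule.sum_mem
    intro m hm
    have hdeg : m 0 + m 1 + m 2 = a := by
      rw [← degree3]
      by_contra hne
      exact (mem_support_iff.mp hm) (hf.coeff_eq_zero hne)
    have e1 : (Ideal.Quotient.mkₐ k I).toLinearMap (monomial m (coeff m f))
        = coeff m f • cl I m := by
      have : (monomial m (coeff m f)) = coeff m f • monomial m (1 : k) := by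
        rw [smul_monomial, smul_eq_mul, mul_one]
      rw [this]
      rfl
    rw [e1]
    apply Submodule.smul_mem
    by_cases hc : m 1 < e ∧ m 2 < h (m 1)
    · apply Submodule.subset_span
      refine ⟨⟨⟨m 1, hc.1⟩, ⟨m 2, hc.2⟩⟩, ?_⟩
      have hm' : mon (a - m 1 - m 2) (m 1) (m 2) = m := by
        apply ext3
        · simp only [mon_0]; omega
        · rfl
        · rfl
      exact congrArg (cl I) hm'
    · have : cl I m = 0 := by
        rw [cl, Ideal.Quotient.eq_zero_iff_mem]
        exact hz m hdeg hc
      rw [this]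
      exact Submodule.zero_mem _

lemma piece_finrank (I : Ideal (MvPolynomial (Fin 3) k)) (a e : ℕ) (h : ℕ → ℕ)
    (hz : ∀ m : Fin 3 →₀ ℕ, m 0 + m 1 + m 2 = a → ¬ (m 1 < e ∧ m 2 < h (m 1)) →
      monomial m (1 : k) ∈ I)
    (hnz : ∀ m : Fin 3 →₀ ℕ, m 0 + m 1 + m 2 = a → m 1 < e → m 2 < h (m 1) → Nz I m)
    (hd : ∀ i j, i < e → j < h i → i + j ≤ a) :
    Module.Finite k (quotPiece k I a) ∧
    Module.finrank k (quotPiece k I a) = ∑ i ∈ Finset.range e, h i := by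
  have hs := piece_span I a e h hz hd
  constructor
  · rw [← hs]
    exact Module.Finite.span_of_finite k (Set.finite_range _)
  · rw [← hs, finrank_span_eq_card]
    · simp [Finset.sum_range]
    · rw [Fintype.linearIndependent_iff]
      intro g hg x
      have hx : Nz I (mon (a - x.1 - x.2) x.1 x.2) := by
        have := hd x.1 x.2 x.1.2 x.2.2
        apply hnz
        · simp only [mon_0, mon_1, mon_2]
          omega
        · exact x.1.2
        · exact x.2.2
      have h2 := congrArg (cf I (mon (a - x.1 - x.2) x.1 x.2)) hg
      rw [map_sum, map_zero, Finset.sum_eq_single x] at h2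
      · rw [map_smul, cf_cl hx, if_pos rfl] at h2
        simpa using h2
      · intro y _ hy
        rw [map_smul, cf_cl hx, if_neg, smul_zero]
        intro heq
        apply hy
        have h1 := congrArg (fun m : Fin 3 →₀ ℕ => m 1) heq
        have h2 := congrArg (fun m : Fin 3 →₀ ℕ => m 2) heq
        simp only [mon_1, mon_2] at h1 h2
        obtain ⟨y1, y2⟩ := y
        obtain ⟨x1, x2⟩ := x
        simp only at h1 h2
        obtain rfl : y1 = x1 := Fin.ext h1
        obtain rfl : y2 = x2 := Fin.ext h2
        rfl
      · simp

/-! ### The map whose kernel is the Hom space -/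

/-- Tuples of values on the generators. -/
abbrev V0 (I : Ideal (MvPolynomial (Fin 3) k)) (e : ℕ) (b : ℕ → ℕ) : Type _ :=
  (i : Fin (e + 1)) → quotPiece k I (i + b i)

/-- Tuples of values on the syzygies. -/
abbrev V1 (I : Ideal (MvPolynomial (Fin 3) k)) (e : ℕ) (b : ℕ → ℕ) : Type _ :=
  (i : Fin e) → quotPiece k I (i + b i + 1)

/-- The syzygy map. -/
noncomputable def T (I : Ideal (MvPolynomial (Fin 3) k)) (e : ℕ) (b : ℕ → ℕ) (hb : Antitone b) :
    V0 I e b →ₗ[k] V1 I e b :=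
  LinearMap.pi fun i : Fin e =>
    (mulP I (mon 0 1 0) (i.castSucc + b i.castSucc) (i + b i + 1) (by simp)).comp
      (LinearMap.proj i.castSucc) -
    (mulP I (mon 0 0 (b i - b (i + 1))) (i.succ + b i.succ) (i + b i + 1) (by
      have := hb (Nat.le_succ i)
      simp only [mon_0, mon_1, mon_2, Fin.val_succ]
      simp only [Nat.succ_eq_add_one] at this
      omega)).comp (LinearMap.proj i.succ)

lemma T_apply (I : Ideal (MvPolynomial (Fin 3) k)) (e : ℕ) (b : ℕ → ℕ) (hb : Antitone b)
    (φ : V0 I e b) (i : Fin e) :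
    ((T I e b hb φ i : quotPiece k I (i + b i + 1)) : MvPolynomial (Fin 3) k ⧸ I) =
      (monomial (mon 0 1 0) (1 : k)) • (φ i.castSucc : MvPolynomial (Fin 3) k ⧸ I) -
      (monomial (mon 0 0 (b i - b (i + 1))) (1 : k)) •
        (φ i.succ : MvPolynomial (Fin 3) k ⧸ I) := rfl

/-- The functional dual to a standard cokernel generator. -/
noncomputable def P (I : Ideal (MvPolynomial (Fin 3) k)) (e : ℕ) (b : ℕ → ℕ) :
    V1 I e b →ₗ[k] ((Σ i : Fin e, Fin (b i)) → k) :=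
  LinearMap.pi fun x => ∑ l : Fin e,
    if (x.1 : ℕ) ≤ l ∧ (x.2 : ℕ) + 1 ≤ b l then
      (cf I (mon (1 + x.1 + (x.2 + 1)) (l - x.1) (b l - (x.2 + 1)))).comp
        ((Submodule.subtype _).comp (LinearMap.proj l))
    else 0

lemma P_apply (I : Ideal (MvPolynomial (Fin 3) k)) (e : ℕ) (b : ℕ → ℕ) (η : V1 I e b)
    (x : Σ i : Fin e, Fin (b i)) :
    P I e b η x = ∑ l : Fin e, if (x.1 : ℕ) ≤ l ∧ (x.2 : ℕ) + 1 ≤ b l then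
      cf I (mon (1 + x.1 + (x.2 + 1)) (l - x.1) (b l - (x.2 + 1)))
        (η l : MvPolynomial (Fin 3) k ⧸ I) else 0 := by
  rw [P, LinearMap.pi_apply, LinearMap.sum_apply]
  apply Finset.sum_congr rfl
  intro l _
  split_ifs <;> rfl

lemma P_comp_T (I : Ideal (MvPolynomial (Fin 3) k)) (e : ℕ) (b : ℕ → ℕ) (hb : Antitone b)
    (hbe : b e = 0)
    (hnz : ∀ m : Fin 3 →₀ ℕ, 0 < m 0 → m 2 < b (m 1) → Nz I m) (φ : V0 I e b) :
    P I e b (T I e b hb φ) = 0 := by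
  funext x
  rw [P_apply, Pi.zero_apply]
  let F : ℕ → k := fun l => if hl : l < e + 1 then
    (if (x.1 : ℕ) < l ∧ (x.2 : ℕ) + 1 ≤ b l then
      cf I (mon (1 + x.1 + (x.2 + 1)) (l - x.1 - 1) (b l - (x.2 + 1)))
        (φ ⟨l, hl⟩ : MvPolynomial (Fin 3) k ⧸ I) else 0) else 0
  have key : ∀ l : Fin e, (if (x.1 : ℕ) ≤ l ∧ (x.2 : ℕ) + 1 ≤ b l then
      cf I (mon (1 + x.1 + (x.2 + 1)) (l - x.1) (b l - (x.2 + 1)))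
        (T I e b hb φ l : MvPolynomial (Fin 3) k ⧸ I) else 0) = F l - F (l + 1) := by
    intro l
    have hl := l.2
    have hbl : b (l + 1) ≤ b l := hb (Nat.le_succ l)
    have hF1 : F l = if (x.1 : ℕ) < l ∧ (x.2 : ℕ) + 1 ≤ b l then
      cf I (mon (1 + x.1 + (x.2 + 1)) (l - x.1 - 1) (b l - (x.2 + 1)))
        (φ l.castSucc : MvPolynomial (Fin 3) k ⧸ I) else 0 := dif_pos (by omega)
    have hF2 : F (l + 1) = if (x.1 : ℕ) < l + 1 ∧ (x.2 : ℕ) + 1 ≤ b (l + 1) then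
      cf I (mon (1 + x.1 + (x.2 + 1)) (l + 1 - x.1 - 1) (b (l + 1) - (x.2 + 1)))
        (φ l.succ : MvPolynomial (Fin 3) k ⧸ I) else 0 := dif_pos (by omega)
    rw [hF1, hF2, T_apply]
    by_cases hc : (x.1 : ℕ) ≤ l ∧ (x.2 : ℕ) + 1 ≤ b l
    · rw [if_pos hc, map_sub]
      have hN : Nz I (mon (1 + x.1 + (x.2 + 1)) (l - x.1) (b l - (x.2 + 1))) := by
        apply hnz
        · simp only [mon_0]; omega
        · simp only [mon_1, mon_2]
          have : b l ≤ b (l - x.1) := hb (Nat.sub_le _ _)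
          omega
      congr 1
      · by_cases h : (x.1 : ℕ) < l
        · rw [if_pos ⟨h, hc.2⟩]
          have e1 : mon (1 + x.1 + (x.2 + 1)) (l - x.1) (b l - (x.2 + 1)) =
            mon 0 1 0 + mon (1 + x.1 + (x.2 + 1)) (l - x.1 - 1) (b l - (x.2 + 1)) := by
            rw [mon_add]; congr 1 <;> omega
          rw [e1] at hN ⊢
          exact cf_smul hN _
        · rw [if_neg (fun h' => h h'.1)]
          apply cf_smul_zero hN
          rw [le3]
          simp only [mon_1]
          omega
      · by_cases h : (x.2 : ℕ) + 1 ≤ b (l + 1)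
        · rw [if_pos ⟨by omega, h⟩]
          have e1 : mon (1 + x.1 + (x.2 + 1)) (l - x.1) (b l - (x.2 + 1)) =
            mon 0 0 (b l - b (l + 1)) +
              mon (1 + x.1 + (x.2 + 1)) (l + 1 - x.1 - 1) (b (l + 1) - (x.2 + 1)) := by
            rw [mon_add]; congr 1 <;> omega
          rw [e1] at hN ⊢
          exact cf_smul hN _
        · rw [if_neg (fun h' => h h'.2)]
          apply cf_smul_zero hN
          rw [le3]
          simp only [mon_2]
          omega
    · rw [if_neg hc, if_neg (by omega), if_neg (by omega), sub_zero]
  rw [Finset.sum_congr rfl (fun l _ => key l), ← Finset.sum_range (fun l => F l - F (l + 1)),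
    Finset.sum_range_sub']
  have h0 : F 0 = 0 := by simp [F]
  have he : F e = 0 := by simp [F, hbe]
  rw [h0, he, sub_zero]

/-- A monomial in one coordinate of `V1`. -/
noncomputable def el (I : Ideal (MvPolynomial (Fin 3) k)) (e : ℕ) (b : ℕ → ℕ) (l : Fin e)
    (m : Fin 3 →₀ ℕ) (h : m 0 + m 1 + m 2 = l + b l + 1) : V1 I e b :=
  Pi.single l ⟨cl I m, cl_mem I m _ h⟩

/-- A monomial in one coordinate of `V0`. -/
noncomputable def el0 (I : Ideal (MvPolynomial (Fin 3) k)) (e : ℕ) (b : ℕ → ℕ) (l : Fin (e + 1))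
    (m : Fin 3 →₀ ℕ) (h : m 0 + m 1 + m 2 = l + b l) : V0 I e b :=
  Pi.single l ⟨cl I m, cl_mem I m _ h⟩

/-- The standard cokernel generators. -/
noncomputable def gen (I : Ideal (MvPolynomial (Fin 3) k)) (e : ℕ) (b : ℕ → ℕ)
    (x : Σ i : Fin e, Fin (b i)) : V1 I e b :=
  el I e b x.1 (mon (1 + x.1 + (x.2 + 1)) 0 (b x.1 - (x.2 + 1))) (by
    have := x.2.2
    simp only [mon_0, mon_1, mon_2]
    omega)

lemma P_gen (I : Ideal (MvPolynomial (Fin 3) k)) (e : ℕ) (b : ℕ → ℕ) (hb : Antitone b)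
    (hnz : ∀ m : Fin 3 →₀ ℕ, 0 < m 0 → m 2 < b (m 1) → Nz I m) (x : Σ i : Fin e, Fin (b i)) :
    P I e b (gen I e b x) = Pi.single x 1 := by
  classical
  funext y
  rw [P_apply, Finset.sum_eq_single x.1]
  · have e1 : ((gen I e b x x.1 : quotPiece k I _) : MvPolynomial (Fin 3) k ⧸ I) =
        cl I (mon (1 + x.1 + (x.2 + 1)) 0 (b x.1 - (x.2 + 1))) := by
      rw [gen, el, Pi.single_eq_same]
    rw [e1]
    by_cases hxy : y = x
    · subst hxy
      have h2 := y.2.2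
      rw [if_pos ⟨le_refl _, by omega⟩, Pi.single_eq_same, cf_cl, if_pos]
      · simp
      · apply hnz
        · simp only [mon_0]; omega
        · simp only [mon_1, mon_2, Nat.sub_self]
          have := hb (Nat.zero_le y.1)
          omega
    · rw [Pi.single_eq_of_ne hxy]
      split_ifs with hc
      · rw [cf_cl, if_neg]
        · intro heq
          apply hxy
          have h0 := congrArg (fun m : Fin 3 →₀ ℕ => m 0) heq
          have h1 := congrArg (fun m : Fin 3 →₀ ℕ => m 1) heq
          simp only [mon_0, mon_1] at h0 h1
          obtain ⟨y1, y2⟩ := y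
          obtain ⟨x1, x2⟩ := x
          simp only at h0 h1 hc
          obtain rfl : y1 = x1 := Fin.ext (by omega)
          obtain rfl : y2 = x2 := Fin.ext (by omega)
          rfl
        · apply hnz
          · simp only [mon_0]; omega
          · simp only [mon_1, mon_2]
            have : b x.1 ≤ b (x.1 - y.1) := hb (Nat.sub_le _ _)
            omega
      · rfl
  · intro l _ hl
    have : gen I e b x l = 0 := by
      rw [gen, el, Pi.single_eq_of_ne hl]
    rw [this]
    simp
  · simp

lemma T_el0_zero (I : Ideal (MvPolynomial (Fin 3) k)) (e : ℕ) (b : ℕ → ℕ) (hb : Antitone b)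
    (l : Fin e) (hl : (l : ℕ) = 0) (m : Fin 3 →₀ ℕ) (h h') :
    T I e b hb (el0 I e b l.castSucc m h) = el I e b l (mon 0 1 0 + m) h' := by
  funext i
  apply Subtype.ext
  rw [T_apply, el0, el, Pi.single_eq_of_ne (i := l.castSucc) (i' := i.succ)]
  · rw [ZeroMemClass.coe_zero, smul_zero, sub_zero]
    by_cases hi : i = l
    · subst hi
      rw [Pi.single_eq_same, Pi.single_eq_same]
      exact smul_cl _ _ _
    · rw [Pi.single_eq_of_ne hi, Pi.single_eq_of_ne, ZeroMemClass.coe_zero,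
        ZeroMemClass.coe_zero, smul_zero]
      exact fun h => hi (Fin.castSucc_injective _ h)
  · intro h
    have := congrArg Fin.val h
    simp [hl] at this

lemma T_el0_last (I : Ideal (MvPolynomial (Fin 3) k)) (e : ℕ) (b : ℕ → ℕ) (hb : Antitone b)
    (l : Fin e) (hl : (l : ℕ) + 1 = e) (m : Fin 3 →₀ ℕ) (h h') :
    T I e b hb (el0 I e b l.succ m h) = - el I e b l (mon 0 0 (b l - b (l + 1)) + m) h' := by
  funext i
  apply Subtype.ext
  rw [T_apply, el0, el, Pi.single_eq_of_ne (i := l.succ) (i' := i.castSucc)]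
  · rw [ZeroMemClass.coe_zero, smul_zero, zero_sub, Pi.neg_apply, NegMemClass.coe_neg]
    congr 1
    by_cases hi : i = l
    · subst hi
      rw [Pi.single_eq_same, Pi.single_eq_same]
      exact smul_cl _ _ _
    · rw [Pi.single_eq_of_ne hi, Pi.single_eq_of_ne, ZeroMemClass.coe_zero,
        ZeroMemClass.coe_zero, smul_zero]
      exact fun h => hi (Fin.succ_injective _ h)
  · intro h
    have := congrArg Fin.val h
    simp at this
    omega

lemma T_el0_mid (I : Ideal (MvPolynomial (Fin 3) k)) (e : ℕ) (b : ℕ → ℕ) (hb : Antitone b)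
    (l l' : Fin e) (hl : (l : ℕ) + 1 = l') (m : Fin 3 →₀ ℕ) (h h' h'') :
    T I e b hb (el0 I e b l.succ m h) = el I e b l' (mon 0 1 0 + m) h'
      - el I e b l (mon 0 0 (b l - b (l + 1)) + m) h'' := by
  have hll : l.succ = l'.castSucc := Fin.ext hl
  have hne : l ≠ l' := by rintro rfl; omega
  funext i
  apply Subtype.ext
  rw [T_apply, el0, el, el, Pi.sub_apply, AddSubgroupClass.coe_sub]
  congr 1
  · by_cases hi : i = l'
    · subst hi
      rw [Pi.single_eq_same]
      have : ∀ (j : Fin (e + 1)) (hj : l.succ = j), ((Pi.single l.succ ⟨cl I m, cl_mem I m _ h⟩ :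
          V0 I e b) j : MvPolynomial (Fin 3) k ⧸ I) = cl I m := by
        rintro _ rfl
        rw [Pi.single_eq_same]
      rw [this _ hll]
      exact smul_cl _ _ _
    · rw [Pi.single_eq_of_ne hi, Pi.single_eq_of_ne, ZeroMemClass.coe_zero,
        ZeroMemClass.coe_zero, smul_zero]
      rw [hll]
      exact fun h => hi (Fin.castSucc_injective _ h)
  · by_cases hi : i = l
    · subst hi
      rw [Pi.single_eq_same, Pi.single_eq_same]
      exact smul_cl _ _ _
    · rw [Pi.single_eq_of_ne hi, Pi.single_eq_of_ne, ZeroMemClass.coe_zero,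
        ZeroMemClass.coe_zero, smul_zero]
      exact fun h => hi (Fin.succ_injective _ h)

lemma el_congr (I : Ideal (MvPolynomial (Fin 3) k)) (e : ℕ) (b : ℕ → ℕ) (l : Fin e)
    {m m' : Fin 3 →₀ ℕ} (hm : m = m') (h h') : el I e b l m h = el I e b l m' h' := by
  subst hm
  rfl

/-- High powers of `α₂` lie in the range. -/
lemma el_mem_range (I : Ideal (MvPolynomial (Fin 3) k)) (e : ℕ) (b : ℕ → ℕ) (hb : Antitone b)
    (hbe : b e = 0) (t : ℕ) : ∀ (l : Fin e) (_ : (l : ℕ) + 1 + t = e) (m : Fin 3 →₀ ℕ) (h)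
    (_ : b l ≤ m 2), el I e b l m h ∈ LinearMap.range (T I e b hb) := by
  induction t with
  | zero =>
    intro l hl m h hm
    have hbl : b (l + 1) = 0 := by rw [add_zero] at hl; rw [hl, hbe]
    have e1 : mon 0 0 (b l - b (l + 1)) + mon (m 0) (m 1) (m 2 - (b l - b (l + 1))) = m := by
      rw [mon_add]
      apply ext3
      · simp
      · simp
      · simp only [mon_2]; omega
    refine ⟨- el0 I e b l.succ (mon (m 0) (m 1) (m 2 - (b l - b (l + 1)))) ?_, ?_⟩
    · simp only [mon_0, mon_1, mon_2, Fin.val_succ]; omega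
    · rw [map_neg, T_el0_last I e b hb l hl _ _ (by rw [e1]; exact h), neg_neg]
      exact el_congr I e b l e1 _ _
  | succ t ih =>
    intro l hl m h hm
    have hbl : b (l + 1) ≤ b l := hb (Nat.le_succ l)
    have e1 : mon 0 0 (b l - b (l + 1)) + mon (m 0) (m 1) (m 2 - (b l - b (l + 1))) = m := by
      rw [mon_add]
      apply ext3
      · simp
      · simp
      · simp only [mon_2]; omega
    have hl' : (l : ℕ) + 1 < e := by omega
    have h1 : (mon 0 1 0 + mon (m 0) (m 1) (m 2 - (b l - b (l + 1)))) 0 +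
        (mon 0 1 0 + mon (m 0) (m 1) (m 2 - (b l - b (l + 1)))) 1 +
        (mon 0 1 0 + mon (m 0) (m 1) (m 2 - (b l - b (l + 1)))) 2 =
        (⟨l + 1, hl'⟩ : Fin e) + b (⟨l + 1, hl'⟩ : Fin e) + 1 := by
      rw [mon_add]
      simp only [mon_0, mon_1, mon_2]; omega
    have h2 := ih ⟨l + 1, hl'⟩ (by simp only; omega) _ h1 (by
      rw [mon_add]; simp only [mon_2]; omega)
    have h3 := T_el0_mid I e b hb l ⟨l + 1, hl'⟩ rfl
      (mon (m 0) (m 1) (m 2 - (b l - b (l + 1))))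
      (by simp only [mon_0, mon_1, mon_2, Fin.val_succ]; omega) h1 (by rw [e1]; exact h)
    rw [el_congr I e b l e1 _ h] at h3
    have h4 := Submodule.sub_mem _ h2 (LinearMap.mem_range_self (T I e b hb)
      (el0 I e b l.succ (mon (m 0) (m 1) (m 2 - (b l - b (l + 1))))
      (by simp only [mon_0, mon_1, mon_2, Fin.val_succ]; omega)))
    rw [h3, sub_sub_cancel] at h4
    exact h4

lemma el_mem_sup (I : Ideal (MvPolynomial (Fin 3) k)) (e : ℕ) (b : ℕ → ℕ) (hb : Antitone b)
    (hbe : b e = 0) (t : ℕ) : ∀ (l : Fin e) (_ : (l : ℕ) = t) (m : Fin 3 →₀ ℕ) (h),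
    el I e b l m h ∈ LinearMap.range (T I e b hb) ⊔
      Submodule.span k (Set.range (gen I e b)) := by
  have zero_case : ∀ (l : Fin e) (m : Fin 3 →₀ ℕ) (h), m 1 = 0 →
    el I e b l m h ∈ LinearMap.range (T I e b hb) ⊔
      Submodule.span k (Set.range (gen I e b)) := by
    intro l m h hm
    by_cases hc : b l ≤ m 2
    · apply Submodule.mem_sup_left
      exact el_mem_range I e b hb hbe (e - l - 1) l (by omega) m h hc
    · apply Submodule.mem_sup_right
      apply Submodule.subset_span
      refine ⟨⟨l, ⟨b l - 1 - m 2, by omega⟩⟩, ?_⟩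
      apply el_congr
      apply ext3
      · simp only [mon_0]; omega
      · simp only [mon_1]; omega
      · simp only [mon_2]; omega
  induction t with
  | zero =>
    intro l hl m h
    by_cases hm : m 1 = 0
    · exact zero_case l m h hm
    have e1 : mon 0 1 0 + mon (m 0) (m 1 - 1) (m 2) = m := by
      rw [mon_add]
      apply ext3
      · simp
      · simp only [mon_1]; omega
      · simp
    apply Submodule.mem_sup_left
    refine ⟨el0 I e b l.castSucc (mon (m 0) (m 1 - 1) (m 2)) ?_, ?_⟩
    · simp only [mon_0, mon_1, mon_2, Fin.val_castSucc]; omega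
    · rw [T_el0_zero I e b hb l hl _ _ (by rw [e1]; exact h)]
      exact el_congr I e b l e1 _ _
  | succ t ih =>
    intro l hl m h
    by_cases hm : m 1 = 0
    · exact zero_case l m h hm
    have e1 : mon 0 1 0 + mon (m 0) (m 1 - 1) (m 2) = m := by
      rw [mon_add]
      apply ext3
      · simp
      · simp only [mon_1]; omega
      · simp
    have ht : t < e := by omega
    have hbl : b (t + 1) ≤ b t := hb (Nat.le_succ t)
    rw [hl] at h
    have h1 : (mon 0 0 (b t - b (t + 1)) + mon (m 0) (m 1 - 1) (m 2)) 0 +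
        (mon 0 0 (b t - b (t + 1)) + mon (m 0) (m 1 - 1) (m 2)) 1 +
        (mon 0 0 (b t - b (t + 1)) + mon (m 0) (m 1 - 1) (m 2)) 2 =
        (⟨t, ht⟩ : Fin e) + b (⟨t, ht⟩ : Fin e) + 1 := by
      rw [mon_add]
      simp only [mon_0, mon_1, mon_2]; omega
    have h2 := ih ⟨t, ht⟩ rfl _ h1
    have h0 : (mon (m 0) (m 1 - 1) (m 2)) 0 + (mon (m 0) (m 1 - 1) (m 2)) 1 +
        (mon (m 0) (m 1 - 1) (m 2)) 2 =
        (Fin.succ (⟨t, ht⟩ : Fin e) : ℕ) + b (Fin.succ (⟨t, ht⟩ : Fin e)) := by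
      simp only [mon_0, mon_1, mon_2, Fin.val_succ]; omega
    have h3 := T_el0_mid I e b hb ⟨t, ht⟩ l hl.symm
      (mon (m 0) (m 1 - 1) (m 2)) h0 (by rw [e1, hl]; exact h) h1
    rw [el_congr I e b l e1 _ (by rw [hl]; exact h)] at h3
    have h4 := Submodule.add_mem _ h2 (Submodule.mem_sup_left
      (LinearMap.mem_range_self (T I e b hb) (el0 I e b _ _ h0)))
    rw [h3] at h4
    rw [add_sub_cancel] at h4
    exact h4

lemma piece_le_of_cl (I : Ideal (MvPolynomial (Fin 3) k)) (a : ℕ)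
    (W : Submodule k (quotPiece k I a))
    (hW : ∀ m h, (⟨cl I m, cl_mem I m a h⟩ : quotPiece k I a) ∈ W) : W = ⊤ := by
  rw [eq_top_iff]
  rintro ⟨y, hy⟩ -
  have : y ∈ W.map (Submodule.subtype _) := by
    obtain ⟨f, hf, rfl⟩ := hy
    rw [SetLike.mem_coe, mem_homogeneousSubmodule] at hf
    rw [f.as_sum, map_sum]
    apply Submodule.sum_mem
    intro m hm
    have hdeg : m 0 + m 1 + m 2 = a := by
      rw [← degree3]
      by_contra hne
      exact (mem_support_iff.mp hm) (hf.coeff_eq_zero hne)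
    have e1 : (Ideal.Quotient.mkₐ k I).toLinearMap (monomial m (coeff m f))
        = coeff m f • cl I m := by
      have : (monomial m (coeff m f)) = coeff m f • monomial m (1 : k) := by
        rw [smul_monomial, smul_eq_mul, mul_one]
      rw [this]
      rfl
    rw [e1]
    apply Submodule.smul_mem
    exact ⟨_, hW m hdeg, rfl⟩
  obtain ⟨z, hz, rfl⟩ := this
  exact hz

lemma sup_eq_top (I : Ideal (MvPolynomial (Fin 3) k)) (e : ℕ) (b : ℕ → ℕ) (hb : Antitone b)
    (hbe : b e = 0) : LinearMap.range (T I e b hb) ⊔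
      Submodule.span k (Set.range (gen I e b)) = ⊤ := by
  set W := LinearMap.range (T I e b hb) ⊔ Submodule.span k (Set.range (gen I e b)) with hWdef
  rw [eq_top_iff]
  intro η _
  have hη : η = ∑ l, Pi.single l (η l) := by
    rw [Finset.univ_sum_single]
  rw [hη]
  apply Submodule.sum_mem
  intro l _
  have := piece_le_of_cl I (l + b l + 1)
    (W.comap (LinearMap.single k (fun l : Fin e => quotPiece k I (l + b l + 1)) l)) (by
      intro m h
      exact el_mem_sup I e b hb hbe l l rfl m h)
  have h2 : η l ∈ W.comap
    (LinearMap.single k (fun l : Fin e => quotPiece k I (l + b l + 1)) l) := by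
    rw [this]; trivial
  exact h2

lemma finrank_ker (I : Ideal (MvPolynomial (Fin 3) k)) (e r : ℕ) (b : ℕ → ℕ) (hb : Antitone b)
    (hbe : b e = 0)
    (hr : ∑ i ∈ Finset.range e, b i = r)
    (hnz : ∀ m : Fin 3 →₀ ℕ, 0 < m 0 → m 2 < b (m 1) → Nz I m)
    (hV0 : ∀ i : Fin (e + 1), Module.Finite k (quotPiece k I (i + b i)) ∧
      Module.finrank k (quotPiece k I (i + b i)) = r)
    (hV1 : ∀ i : Fin e, Module.Finite k (quotPiece k I (i + b i + 1)) ∧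
      Module.finrank k (quotPiece k I (i + b i + 1)) = r) :
    Module.finrank k (LinearMap.ker (T I e b hb)) = 2 * r := by
  have := fun i => (hV0 i).1
  have := fun i => (hV1 i).1
  have hcard : Fintype.card (Σ i : Fin e, Fin (b i)) = r := by
    rw [← hr]; simp [Finset.sum_range]
  have d0 : Module.finrank k (V0 I e b) = (e + 1) * r := by
    rw [Module.finrank_pi_fintype, Finset.sum_congr rfl (fun i _ => (hV0 i).2)]
    simp
  have d1 : Module.finrank k (V1 I e b) = e * r := by
    rw [Module.finrank_pi_fintype, Finset.sum_congr rfl (fun i _ => (hV1 i).2)]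
    simp
  have rn := LinearMap.finrank_range_add_finrank_ker (T I e b hb)
  have rnP := LinearMap.finrank_range_add_finrank_ker (P I e b)
  have hsurj : LinearMap.range (P I e b) = ⊤ := by
    rw [eq_top_iff]
    intro y _
    refine ⟨∑ x, y x • gen I e b x, ?_⟩
    rw [map_sum]
    simp_rw [map_smul, P_gen I e b hb hnz]
    funext z
    classical
    simp [Finset.sum_apply, Pi.single_apply]
  rw [hsurj, finrank_top, Module.finrank_fintype_fun_eq_card, hcard, d1] at rnP
  have hle : LinearMap.range (T I e b hb) ≤ LinearMap.ker (P I e b) := by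
    rintro _ ⟨φ, rfl⟩
    exact P_comp_T I e b hb hbe hnz φ
  have h1 := Submodule.finrank_mono hle
  have h2 := Submodule.finrank_add_le_finrank_add_finrank (LinearMap.range (T I e b hb))
    (Submodule.span k (Set.range (gen I e b)))
  have h3 := finrank_range_le_card (R := k) (gen I e b)
  rw [Set.finrank, hcard] at h3
  rw [sup_eq_top I e b hb hbe, finrank_top, d1] at h2
  rw [d0, add_mul, one_mul] at rn
  omega

/-! ### Identification of the Hom space with the kernel -/

lemma monomial_mem (J : Ideal (MvPolynomial (Fin 3) k)) (b : ℕ → ℕ)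
    (hJ : ∀ f, f ∈ J ↔ ∀ m ∈ f.support, b (m 1) ≤ m 2) (m : Fin 3 →₀ ℕ) (c : k)
    (h : b (m 1) ≤ m 2) : monomial m c ∈ J := by
  rw [hJ]
  intro n hn
  have := Finset.mem_singleton.mp (support_monomial_subset hn)
  rwa [this]

/-- The generators of `J`. -/
noncomputable def gJ (J : Ideal (MvPolynomial (Fin 3) k)) (b : ℕ → ℕ)
    (hJ : ∀ f, f ∈ J ↔ ∀ m ∈ f.support, b (m 1) ≤ m 2) (i : ℕ) : J :=
  ⟨monomial (mon 0 i (b i)) 1, monomial_mem J b hJ _ _ le_rfl⟩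

/-- Evaluation on generators. -/
noncomputable def ev (J I : Ideal (MvPolynomial (Fin 3) k)) (e : ℕ) (b : ℕ → ℕ)
    (hJ : ∀ f, f ∈ J ↔ ∀ m ∈ f.support, b (m 1) ≤ m 2) : Hom0 k J I →ₗ[k] V0 I e b where
  toFun φ i := ⟨φ.1 (gJ J b hJ i), φ.2 _ _ (isHomogeneous_monomial _ (by
    rw [degree3]; simp))⟩
  map_add' φ ψ := rfl
  map_smul' c φ := rfl

lemma ev_apply (J I : Ideal (MvPolynomial (Fin 3) k)) (e : ℕ) (b : ℕ → ℕ)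
    (hJ : ∀ f, f ∈ J ↔ ∀ m ∈ f.support, b (m 1) ≤ m 2) (φ : Hom0 k J I) (i : Fin (e + 1)) :
    ((ev J I e b hJ φ i : quotPiece k I _) : MvPolynomial (Fin 3) k ⧸ I) =
      φ.1 (gJ J b hJ i) := rfl

lemma ev_injective (J I : Ideal (MvPolynomial (Fin 3) k)) (e : ℕ) (b : ℕ → ℕ) (hb : Antitone b)
    (hbe : b e = 0)
    (hJ : ∀ f, f ∈ J ↔ ∀ m ∈ f.support, b (m 1) ≤ m 2) :
    Function.Injective (ev J I e b hJ) := by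
  intro φ ψ hφ
  have h0 : ∀ i, i ≤ e → gJ J b hJ i ∈ LinearMap.eqLocus φ.1 ψ.1 := by
    intro i hi
    have := congrArg (fun v : V0 I e b =>
      (v ⟨i, by omega⟩ : MvPolynomial (Fin 3) k ⧸ I)) hφ
    exact this
  apply Subtype.ext
  apply LinearMap.ext
  intro f
  have hf : (f : MvPolynomial (Fin 3) k) ∈ (LinearMap.eqLocus φ.1 ψ.1).map J.subtype := by
    rw [(f : MvPolynomial (Fin 3) k).as_sum]
    apply Submodule.sum_mem
    intro m hm
    have hm2 := (hJ f).1 f.2 m hm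
    have hbm : b (min (m 1) e) ≤ m 2 := by
      rcases le_total (m 1) e with h | h
      · rw [min_eq_left h]; exact hm2
      · rw [min_eq_right h, hbe]; exact Nat.zero_le _
    refine ⟨monomial (mon (m 0) (m 1 - min (m 1) e) (m 2 - b (min (m 1) e)))
      (coeff m (f : MvPolynomial (Fin 3) k)) • gJ J b hJ (min (m 1) e),
      Submodule.smul_mem _ _ (h0 _ (min_le_right _ _)), ?_⟩
    rw [map_smul, smul_eq_mul]
    change _ * monomial (mon 0 _ _) 1 = _
    rw [monomial_mul, mul_one, mon_add]
    congr 2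
    apply ext3
    · simp
    · simp only [mon_1]; omega
    · simp only [mon_2]; omega
  obtain ⟨g, hg, hgf⟩ := hf
  have : g = f := Subtype.ext hgf
  rw [← this]
  exact hg

lemma range_le (J I : Ideal (MvPolynomial (Fin 3) k)) (e : ℕ) (b : ℕ → ℕ) (hb : Antitone b)
    (hJ : ∀ f, f ∈ J ↔ ∀ m ∈ f.support, b (m 1) ≤ m 2) :
    LinearMap.range (ev J I e b hJ) ≤ LinearMap.ker (T I e b hb) := by
  rintro _ ⟨φ, rfl⟩
  rw [LinearMap.mem_ker]
  funext i
  apply Subtype.ext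
  rw [T_apply, ev_apply, ev_apply, ← map_smul, ← map_smul, ← map_sub]
  have : b (i + 1) ≤ b i := hb (Nat.le_succ i)
  have h : (monomial (mon 0 1 0) (1 : k)) • gJ J b hJ i.castSucc -
      (monomial (mon 0 0 (b i - b (i + 1))) (1 : k)) • gJ J b hJ i.succ = 0 := by
    apply Subtype.ext
    change monomial _ (1 : k) * monomial (mon 0 _ _) (1 : k) -
      monomial _ (1 : k) * monomial (mon 0 _ _) (1 : k) = 0
    rw [monomial_mul, monomial_mul, mon_add, mon_add]
    have : mon (0 + 0) (1 + (i.castSucc : ℕ)) (0 + b i.castSucc) =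
        mon (0 + 0) (0 + (i.succ : ℕ)) (b i - b (i + 1) + b i.succ) := by
      apply ext3
      · rfl
      · simp only [mon_1, Fin.val_succ, Fin.val_castSucc]; omega
      · simp only [mon_2, Fin.val_succ, Fin.val_castSucc]; omega
    rw [this, sub_self]
  rw [h, map_zero]
  rfl

/-- The `k`-linear map extending values on generators. -/
noncomputable def Phi (I : Ideal (MvPolynomial (Fin 3) k)) (b : ℕ → ℕ)
    (μ : ℕ → MvPolynomial (Fin 3) k ⧸ I) :
    MvPolynomial (Fin 3) k →ₗ[k] (MvPolynomial (Fin 3) k ⧸ I) :=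
  (basisMonomials (Fin 3) k).constr k
    (fun n => (monomial (mon (n 0) 0 (n 2 - b (n 1))) (1 : k)) • μ (n 1))

lemma Phi_monomial (I : Ideal (MvPolynomial (Fin 3) k)) (b : ℕ → ℕ)
    (μ : ℕ → MvPolynomial (Fin 3) k ⧸ I) (n : Fin 3 →₀ ℕ) (c : k) :
    Phi I b μ (monomial n c) =
      (monomial (mon (n 0) 0 (n 2 - b (n 1))) c) • μ (n 1) := by
  have h1 : monomial n c = c • (basisMonomials (Fin 3) k) n := by
    rw [coe_basisMonomials, smul_monomial, smul_eq_mul, mul_one]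
  have h2 : monomial (mon (n 0) 0 (n 2 - b (n 1))) c =
      c • monomial (mon (n 0) 0 (n 2 - b (n 1))) (1 : k) := by
    rw [smul_monomial, smul_eq_mul, mul_one]
  rw [h1, map_smul, Phi, Module.Basis.constr_basis, h2, smul_assoc]

lemma mu_iter (I : Ideal (MvPolynomial (Fin 3) k)) (b : ℕ → ℕ) (hb : Antitone b)
    (μ : ℕ → MvPolynomial (Fin 3) k ⧸ I)
    (hμ : ∀ i, (monomial (mon 0 1 0) (1 : k)) • μ i =
      (monomial (mon 0 0 (b i - b (i + 1))) (1 : k)) • μ (i + 1)) (i t : ℕ) :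
    (monomial (mon 0 t 0) (1 : k)) • μ i =
      (monomial (mon 0 0 (b i - b (i + t))) (1 : k)) • μ (i + t) := by
  induction t with
  | zero => simp
  | succ t ih =>
    have e1 : mon 0 (t + 1) 0 = mon 0 1 0 + mon 0 t 0 := by
      rw [mon_add]; congr 1; omega
    have h1 : b (i + t) ≤ b i := hb (Nat.le_add_right _ _)
    have h2 : b (i + (t + 1)) ≤ b (i + t) := hb (by omega)
    have e2 : mon 0 0 (b i - b (i + (t + 1))) =
        mon 0 0 (b i - b (i + t)) + mon 0 0 (b (i + t) - b (i + (t + 1))) := by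
      rw [mon_add]; congr 1; omega
    rw [e1, e2, ← one_mul (1 : k), ← monomial_mul, ← monomial_mul, mul_smul, mul_smul,
      ih, smul_smul, mul_comm, mul_smul, hμ (i + t)]
    rfl

lemma Phi_mul (I J : Ideal (MvPolynomial (Fin 3) k)) (b : ℕ → ℕ) (hb : Antitone b)
    (hJ : ∀ f, f ∈ J ↔ ∀ m ∈ f.support, b (m 1) ≤ m 2)
    (μ : ℕ → MvPolynomial (Fin 3) k ⧸ I)
    (hμ : ∀ i, (monomial (mon 0 1 0) (1 : k)) • μ i =
      (monomial (mon 0 0 (b i - b (i + 1))) (1 : k)) • μ (i + 1))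
    (g f : MvPolynomial (Fin 3) k) (hf : f ∈ J) :
    Phi I b μ (g * f) = g • Phi I b μ f := by
  have mono : ∀ (m n : Fin 3 →₀ ℕ) (c c' : k), b (n 1) ≤ n 2 →
      Phi I b μ (monomial m c * monomial n c') = monomial m c • Phi I b μ (monomial n c') := by
    intro m n c c' hn
    have h1 : b (n 1 + m 1) ≤ b (n 1) := hb (Nat.le_add_right _ _)
    rw [monomial_mul, Phi_monomial, Phi_monomial, smul_smul, monomial_mul]
    have e1 : m + mon (n 0) 0 (n 2 - b (n 1)) =
        mon (m 0 + n 0) 0 (m 2 + (n 2 - b (n 1))) + mon 0 (m 1) 0 := by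
      rw [mon_add]
      apply ext3 <;> simp
    have e2 : mon ((m + n) 0) 0 ((m + n) 2 - b ((m + n) 1)) =
        mon (m 0 + n 0) 0 (m 2 + (n 2 - b (n 1))) + mon 0 0 (b (n 1) - b (n 1 + m 1)) := by
      rw [mon_add]
      apply ext3
      · simp
      · simp
      · simp only [mon_2, Finsupp.add_apply, add_comm (m 1)]; omega
    rw [e1, e2, ← mul_one (c * c'), ← monomial_mul, ← monomial_mul, mul_smul, mul_smul,
      mu_iter I b hb μ hμ (n 1) (m 1), Finsupp.add_apply, add_comm (m 1)]
  have h2 : ∀ (m : Fin 3 →₀ ℕ) (c : k),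
      Phi I b μ (monomial m c * f) = monomial m c • Phi I b μ f := by
    intro m c
    have hs : Phi I b μ (monomial m c * ∑ n ∈ f.support, monomial n (coeff n f)) =
        monomial m c • Phi I b μ (∑ n ∈ f.support, monomial n (coeff n f)) := by
      rw [Finset.mul_sum, map_sum, map_sum, Finset.smul_sum]
      apply Finset.sum_congr rfl
      intro n hn
      exact mono m n c _ ((hJ f).1 hf n hn)
    rwa [← f.as_sum] at hs
  have h3 : Phi I b μ ((∑ n ∈ g.support, monomial n (coeff n g)) * f) =
      (∑ n ∈ g.support, monomial n (coeff n g)) • Phi I b μ f := by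
    rw [Finset.sum_mul, map_sum, Finset.sum_smul]
    exact Finset.sum_congr rfl (fun n _ => h2 n _)
  rwa [← g.as_sum] at h3

lemma ker_le (J I : Ideal (MvPolynomial (Fin 3) k)) (e : ℕ) (b : ℕ → ℕ) (hb : Antitone b)
    (hbe : b e = 0)
    (hJ : ∀ f, f ∈ J ↔ ∀ m ∈ f.support, b (m 1) ≤ m 2) :
    LinearMap.ker (T I e b hb) ≤ LinearMap.range (ev J I e b hJ) := by
  intro v hv
  rw [LinearMap.mem_ker] at hv
  have hb0 : ∀ i, e ≤ i → b i = 0 := fun i hi => Nat.le_zero.mp (hbe ▸ hb hi)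
  let μ : ℕ → MvPolynomial (Fin 3) k ⧸ I := fun i =>
    (monomial (mon 0 (i - e) 0) (1 : k)) •
      (v ⟨min i e, by omega⟩ : MvPolynomial (Fin 3) k ⧸ I)
  have hμ1 : ∀ (i : ℕ) (hi : i < e + 1), μ i = (v ⟨i, hi⟩ : MvPolynomial (Fin 3) k ⧸ I) := by
    intro i hi
    have h1 : mon 0 (i - e) 0 = 0 := by
      apply ext3
      · rfl
      · simp only [mon_1, Finsupp.coe_zero, Pi.zero_apply]; omega
      · rfl
    have h2 : ∀ j (hj : j < e + 1), j = i →
      (v ⟨j, hj⟩ : MvPolynomial (Fin 3) k ⧸ I) = v ⟨i, hi⟩ := by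
      rintro j hj rfl; rfl
    simp only [μ]
    rw [h1, h2 (min i e) _ (by omega)]
    exact one_smul (MvPolynomial (Fin 3) k) _
  have hμ : ∀ i, (monomial (mon 0 1 0) (1 : k)) • μ i =
      (monomial (mon 0 0 (b i - b (i + 1))) (1 : k)) • μ (i + 1) := by
    intro i
    rcases lt_or_ge i e with hi | hi
    · rw [hμ1 i (by omega), hμ1 (i + 1) (by omega)]
      have h1 := T_apply I e b hb v ⟨i, hi⟩
      rw [hv] at h1
      exact (sub_eq_zero.mp h1.symm)
    · have h1 : b i - b (i + 1) = 0 := by rw [hb0 i hi]; omega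
      rw [h1]
      have h3 : ∀ j j' (hj : j < e + 1) (hj' : j' < e + 1), j = j' →
        (v ⟨j, hj⟩ : MvPolynomial (Fin 3) k ⧸ I) = v ⟨j', hj'⟩ := by
        rintro j j' hj hj' rfl; rfl
      simp only [μ]
      rw [h3 (min i e) (min (i + 1) e) (by omega) (by omega) (by omega), smul_smul, smul_smul,
        monomial_mul, monomial_mul, mon_add, mon_add]
      congr 3
      congr 1
      omega
  have hμd : ∀ i, μ i ∈ quotPiece k I (i + b i) := by
    intro i
    have hv2 := (v ⟨min i e, by omega⟩).2
    refine smul_mem_piece I _ _ _ ?_ hv2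
    simp only [mon_0, mon_1, mon_2]
    rcases le_total i e with h | h
    · rw [min_eq_left h]; omega
    · rw [min_eq_right h, hb0 i h, hbe]; omega
  let φ : J →ₗ[MvPolynomial (Fin 3) k] (MvPolynomial (Fin 3) k ⧸ I) :=
    { toFun := fun f => Phi I b μ f
      map_add' := fun f g => map_add (Phi I b μ) _ _
      map_smul' := fun g f => Phi_mul I J b hb hJ μ hμ g f f.2 }
  have hφ : φ ∈ Hom0 k J I := by
    intro d f hf
    change Phi I b μ f ∈ _
    rw [(f : MvPolynomial (Fin 3) k).as_sum, map_sum]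
    apply Submodule.sum_mem
    intro n hn
    have hdeg : n 0 + n 1 + n 2 = d := by
      rw [← degree3]
      by_contra hne
      exact (mem_support_iff.mp hn) (hf.coeff_eq_zero hne)
    have hn2 := (hJ f).1 f.2 n hn
    rw [← mul_one (coeff n (f : MvPolynomial (Fin 3) k)), ← smul_eq_mul, ← smul_monomial,
      map_smul]
    apply Submodule.smul_mem
    rw [Phi_monomial]
    refine smul_mem_piece I _ _ _ ?_ (hμd _)
    simp only [mon_0, mon_1, mon_2]
    omega
  refine ⟨⟨φ, hφ⟩, ?_⟩
  funext i
  apply Subtype.ext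
  rw [ev_apply]
  change Phi I b μ (monomial _ 1) = _
  rw [Phi_monomial]
  simp only [mon_0, mon_1, mon_2, Nat.sub_self]
  rw [hμ1 i i.2]
  have h1 : mon 0 0 0 = 0 := ext3 rfl rfl rfl
  rw [h1]
  exact one_smul (MvPolynomial (Fin 3) k) (v i : MvPolynomial (Fin 3) k ⧸ I)

lemma finrank_Hom0 (J I : Ideal (MvPolynomial (Fin 3) k)) (e : ℕ) (b : ℕ → ℕ) (hb : Antitone b)
    (hbe : b e = 0)
    (hJ : ∀ f, f ∈ J ↔ ∀ m ∈ f.support, b (m 1) ≤ m 2) :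
    Module.finrank k (Hom0 k J I) = Module.finrank k (LinearMap.ker (T I e b hb)) := by
  rw [← LinearMap.finrank_range_of_inj (ev_injective J I e b hb hbe hJ),
    le_antisymm (range_le J I e b hb hJ) (ker_le J I e b hb hbe hJ)]

/-! ### The concrete ideals -/

/-- The staircase. -/
def bb (e p q i : ℕ) : ℕ := (e - i) + (if i < p then 1 else 0) + (if i < q then 1 else 0)

lemma bb_antitone (e p q : ℕ) : Antitone (bb e p q) := by
  intro i j hij
  unfold bb
  split_ifs <;> omega

lemma XX (i j : ℕ) : (X 1 ^ i * X 2 ^ j : MvPolynomial (Fin 3) k) = monomial (mon 0 i j) 1 := by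
  rw [X_pow_eq_monomial, X_pow_eq_monomial, monomial_mul, one_mul]
  congr 2
  apply ext3 <;> simp

lemma XX2 (i j : ℕ) : (X 1 ^ i * X 2 ^ j * X 2 : MvPolynomial (Fin 3) k) =
    monomial (mon 0 i (j + 1)) 1 := by
  rw [mul_assoc, ← pow_succ, XX]

lemma XX0 (i j : ℕ) : (X 1 ^ i * X 2 ^ j * X 0 : MvPolynomial (Fin 3) k) =
    monomial (mon 1 i j) 1 := by
  rw [XX, X, monomial_mul, one_mul]
  congr 2
  apply ext3 <;> simp

lemma A_eq (e : ℕ) : A k e = fun i => monomial (mon 0 i (e - i)) 1 := by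
  funext i
  rw [A, XX]

lemma B_eq (e : ℕ) : B k e = fun i => monomial (mon 0 i (e + 1 - i)) 1 := by
  funext i
  rw [B, XX]

lemma C_eq (e : ℕ) : _root_.C k e = fun i => monomial (mon 0 i (e + 2 - i)) 1 := by
  funext i
  rw [_root_.C, XX]

lemma A2_eq (e : ℕ) : (fun i => A k e i * X 2) = fun i => monomial (mon 0 i (e - i + 1)) 1 := by
  funext i
  rw [A, XX2]

lemma A0_eq (e : ℕ) : (fun i => A k e i * X 0) = fun i => monomial (mon 1 i (e - i)) 1 := by
  funext i
  rw [A, XX0]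

lemma mem_Jf (e p q s : ℕ) (hp : 0 < p) (hq : 0 < q) (hqp : q ≤ p) (hpq : p + q ≤ e)
    (f : MvPolynomial (Fin 3) k) :
    f ∈ Jf k e (s + p) (s + p + q) s ↔ ∀ m ∈ f.support, bb e p q (m 1) ≤ m 2 := by
  have hJ : Jf k e (s + p) (s + p + q) s = Ideal.span ((fun m => monomial m (1 : k)) ''
      ((fun i => mon 0 i (e - i)) '' Set.Icc p e ∪
        (fun i => mon 0 i (e + 1 - i)) '' Set.Icc q (p - 1) ∪
        (fun i => mon 0 i (e + 2 - i)) '' Set.Iic (q - 1))) := by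
    have h1 : s + p - s = p := by omega
    have h2 : s + p + q - (s + p) = q := by omega
    rw [Jf, A_eq, B_eq, C_eq, h1, h2]
    simp only [Set.image_union, Set.image_image]
  rw [hJ, mem_ideal_span_monomial_image]
  refine forall₂_congr (fun m _ => ?_)
  constructor
  · rintro ⟨n, hn, hnm⟩
    rw [le3] at hnm
    unfold bb
    rcases hn with (⟨i, hi, rfl⟩ | ⟨i, hi, rfl⟩) | ⟨i, hi, rfl⟩ <;>
    · simp only [mon_0, mon_1, mon_2, Set.mem_Icc, Set.mem_Iic] at hnm hi
      split_ifs <;> omega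
  · intro h
    unfold bb at h
    by_cases h1 : m 1 < q
    · refine ⟨_, Or.inr ⟨m 1, ?_, rfl⟩, ?_⟩
      · rw [Set.mem_Iic]; omega
      · rw [le3]
        simp only [mon_0, mon_1, mon_2]
        split_ifs at h <;> omega
    · by_cases h2 : m 1 < p
      · refine ⟨_, Or.inl (Or.inr ⟨m 1, ?_, rfl⟩), ?_⟩
        · rw [Set.mem_Icc]; omega
        · rw [le3]
          simp only [mon_0, mon_1, mon_2]
          split_ifs at h <;> omega
      · refine ⟨_, Or.inl (Or.inl ⟨min (m 1) e, ?_, rfl⟩), ?_⟩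
        · rw [Set.mem_Icc]; omega
        · rw [le3]
          simp only [mon_0, mon_1, mon_2]
          split_ifs at h <;> omega

/-- Membership of an exponent in the monomial ideal `I`. -/
def inI (e p q : ℕ) (m : Fin 3 →₀ ℕ) : Prop :=
  bb e p q (m 1) ≤ m 2 ∧ ¬ (m 0 = 0 ∧ m 1 + m 2 = e ∧ m 1 < p + q)

lemma mem_If (e p q s : ℕ) (hp : 0 < p) (hq : 0 < q) (hqp : q ≤ p) (hpq : p + q ≤ e)
    (f : MvPolynomial (Fin 3) k) :
    f ∈ If k e (s + p) (s + p + q) s ↔ ∀ m ∈ f.support, inI e p q m := by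
  have hI : If k e (s + p) (s + p + q) s = Ideal.span ((fun m => monomial m (1 : k)) ''
      ((fun i => mon 0 i (e - i)) '' Set.Icc (p + q) e ∪
        (fun i => mon 0 i (e - i + 1)) '' Set.Icc p (p + q - 1) ∪
        (fun i => mon 1 i (e - i)) '' Set.Icc p (p + q - 1) ∪
        (fun i => mon 0 i (e + 1 - i)) '' Set.Icc q (p - 1) ∪
        (fun i => mon 0 i (e + 2 - i)) '' Set.Iic (q - 1))) := by
    have h1 : s + p - s = p := by omega
    have h2 : s + p + q - (s + p) = q := by omega
    have h3 : s + p + q - s = p + q := by omega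
    rw [If, A2_eq, A0_eq, A_eq, B_eq, C_eq, h1, h2, h3]
    simp only [Set.image_union, Set.image_image]
  rw [hI, mem_ideal_span_monomial_image]
  refine forall₂_congr (fun m _ => ?_)
  constructor
  · rintro ⟨n, hn, hnm⟩
    rw [le3] at hnm
    unfold inI bb
    rcases hn with (((⟨i, hi, rfl⟩ | ⟨i, hi, rfl⟩) | ⟨i, hi, rfl⟩) | ⟨i, hi, rfl⟩) | ⟨i, hi, rfl⟩ <;>
    · simp only [mon_0, mon_1, mon_2, Set.mem_Icc, Set.mem_Iic] at hnm hi
      split_ifs <;> omega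
  · rintro ⟨h, h'⟩
    unfold bb at h
    by_cases h1 : m 1 < q
    · refine ⟨_, Or.inr ⟨m 1, ?_, rfl⟩, ?_⟩
      · rw [Set.mem_Iic]; omega
      · rw [le3]
        simp only [mon_0, mon_1, mon_2]
        split_ifs at h <;> omega
    by_cases h2 : m 1 < p
    · refine ⟨_, Or.inl (Or.inr ⟨m 1, ?_, rfl⟩), ?_⟩
      · rw [Set.mem_Icc]; omega
      · rw [le3]
        simp only [mon_0, mon_1, mon_2]
        split_ifs at h <;> omega
    rw [if_neg h1, if_neg h2] at h
    by_cases h3 : m 1 < p + q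
    · by_cases h4 : m 0 = 0
      · refine ⟨_, Or.inl (Or.inl (Or.inl (Or.inr ⟨m 1, ?_, rfl⟩))), ?_⟩
        · rw [Set.mem_Icc]; omega
        · rw [le3]
          simp only [mon_0, mon_1, mon_2]
          omega
      · refine ⟨_, Or.inl (Or.inl (Or.inr ⟨m 1, ?_, rfl⟩)), ?_⟩
        · rw [Set.mem_Icc]; omega
        · rw [le3]
          simp only [mon_0, mon_1, mon_2]
          omega
    · refine ⟨_, Or.inl (Or.inl (Or.inl (Or.inl ⟨min (m 1) e, ?_, rfl⟩))), ?_⟩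
      · rw [Set.mem_Icc]; omega
      · rw [le3]
        simp only [mon_0, mon_1, mon_2]
        omega

lemma sum_sub (e : ℕ) : ∑ i ∈ Finset.range e, (e - i) = (e + 1).choose 2 := by
  induction e with
  | zero => rfl
  | succ e ih =>
    rw [Finset.sum_range_succ']
    simp only [Nat.add_sub_add_right, Nat.sub_zero]
    rw [ih, Nat.choose_succ_succ' (e + 1) 1, Nat.choose_one_right]
    simp only [Nat.reduceAdd]
    omega

lemma sum_ite_lt (e t : ℕ) (h : t ≤ e) :
    ∑ i ∈ Finset.range e, (if i < t then 1 else 0) = t := by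
  rw [← Finset.card_filter]
  have : (Finset.range e).filter (fun i => i < t) = Finset.range t := by
    ext i
    simp only [Finset.mem_filter, Finset.mem_range]
    omega
  rw [this, Finset.card_range]

lemma main (e p q s : ℕ) (hs : s = (e + 1).choose 2) (hp : 0 < p) (hq : 0 < q) (hqp : q ≤ p)
    (hpq : p + q ≤ e) :
    Module.finrank k (Hom0 k (Jf k e (s + p) (s + p + q) s) (If k e (s + p) (s + p + q) s)) =
      2 * (s + p + q) := by
  have hb := bb_antitone e p q
  have hbe : bb e p q e = 0 := by
    unfold bb
    rw [if_neg (by omega), if_neg (by omega)]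
    omega
  have hI := mem_If (k := k) e p q s hp hq hqp hpq
  set I := If k e (s + p) (s + p + q) s
  have hIm : ∀ m, inI e p q m → monomial m (1 : k) ∈ I := by
    intro m hm
    rw [hI]
    intro n hn
    rwa [Finset.mem_singleton.mp (support_monomial_subset hn)]
  have hIn : ∀ m, ¬ inI e p q m → Nz I m := by
    intro m hm f hf
    by_contra hc
    exact hm ((hI f).1 hf m (mem_support_iff.mpr hc))
  have hsum : ∑ i ∈ Finset.range e, bb e p q i = s + p + q := by
    unfold bb
    rw [Finset.sum_add_distrib, Finset.sum_add_distrib, sum_sub, sum_ite_lt e p (by omega),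
      sum_ite_lt e q (by omega), hs]
  have hdim1 : ∀ a, e < a → Module.Finite k (quotPiece k I a) ∧
      Module.finrank k (quotPiece k I a) = s + p + q := by
    intro a ha
    rw [← hsum]
    apply piece_finrank
    · intro m hm hc
      apply hIm
      refine ⟨?_, by omega⟩
      by_contra h
      apply hc
      refine ⟨?_, by omega⟩
      by_contra h2
      have := hb (not_lt.mp h2)
      omega
    · intro m _ _ h2
      apply hIn
      intro h
      have := h.1
      omega
    · intro i j hi hj
      unfold bb at hj
      split_ifs at hj <;> omega
  have hdim0 : Module.Finite k (quotPiece k I e) ∧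
      Module.finrank k (quotPiece k I e) = s + p + q := by
    have : ∑ i ∈ Finset.range e, (e - i + if i < p + q then 1 else 0) = s + p + q := by
      rw [Finset.sum_add_distrib, sum_sub, sum_ite_lt e (p + q) hpq, hs, add_assoc]
    rw [← this]
    apply piece_finrank I e e (fun i => e - i + if i < p + q then 1 else 0)
    · intro m hm hc
      apply hIm
      unfold inI bb
      split_ifs at hc ⊢ <;> omega
    · intro m hm h1 h2
      apply hIn
      unfold inI bb
      split_ifs at h2 ⊢ <;> omega
    · intro i j hi hj
      split_ifs at hj <;> omega
  rw [finrank_Hom0 _ I e (bb e p q) hb hbe (mem_Jf e p q s hp hq hqp hpq)]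
  apply finrank_ker I e _ _ hb hbe hsum
  · intro m h0 h2
    apply hIn
    intro h
    have := h.1
    omega
  · intro i
    have hi := i.2
    by_cases hc : (i : ℕ) + bb e p q i = e
    · rw [hc]; exact hdim0
    · apply hdim1
      unfold bb at hc ⊢
      omega
  · intro i
    apply hdim1
    unfold bb
    omega

end HomJ

theorem finrank_hom0_J_eq_two_r (k : Type*) [Field k] [IsAlgClosed k]
    (e d r s : ℕ) (hs : s = (e+1).choose 2)
    (h1 : s < d) (h2 : d < r) (h3 : r < (e+2).choose 2) (h4 : r - d ≤ d - s) :
    Module.finrank k ↥(Hom0 k (Jf k e d r s) (If k e d r s)) = 2 * r := by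
  have hc : (e + 2).choose 2 = (e + 1).choose 2 + (e + 1) := by
    rw [Nat.choose_succ_succ' (e + 1) 1, Nat.choose_one_right]
    simp only [Nat.reduceAdd]
    omega
  obtain ⟨p, rfl⟩ := Nat.exists_eq_add_of_lt h1
  obtain ⟨q, rfl⟩ := Nat.exists_eq_add_of_lt h2
  exact HomJ.main e (p + 1) (q + 1) s hs (by omega) (by omega) (by omega) (by omega)
end

section
/- Let S = k[α_0, α_1, α_2] and fix integers e, d, r with C(e+1, 2) < d < r < C(e+2, 2) and r − d ≤ d − s, where s = C(e+1, 2) = dim_k S_{e−1}. Set A_i = α_1^i α_2^{e−i}, B_i = α_1^i α_2^{e+1−i}, C_i = α_1^i α_2^{e+2−i}, and let I = (A_i for r−s ≤ i ≤ e; A_i·α_2 and A_i·α_0 for d−s ≤ i ≤ r−s−1; B_i for r−d ≤ i ≤ d−s−1; C_i for 0 ≤ i ≤ r−d−1). Then dim_k Hom_S(I, S/I)_0 ≤ 2r. -/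
open MvPolynomial

section abstractBound
variable {k R : Type*} [Field k] [CommRing R] [Algebra k R]

/-- The syzygy map of a two-variable monomial ideal with column heights `h`. -/
noncomputable def syzMap (e : ℕ) (h : ℕ → ℕ) (y z : R) :
    (Fin (e+1) → R) →ₗ[R] (Fin e → R) where
  toFun v i := y * v i.castSucc - z ^ (h i - h (i+1)) * v i.succ
  map_add' u v := by ext i; simp; ring
  map_smul' a v := by ext i; simp; ring

lemma aux_finite (e : ℕ) (h : ℕ → ℕ) (hanti : Antitone h) (he : h e = 0) (y z : R)
    (hspan : Submodule.span k (Set.range fun bc : ℕ × ℕ => y ^ bc.1 * z ^ bc.2) = ⊤)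
    (hzero : ∀ b, y ^ b * z ^ (h b) = 0) :
    Module.Finite k R ∧ Module.finrank k R ≤ ∑ i ∈ Finset.range e, h i := by
  let g : (Σ i : Fin e, Fin (h i)) → R := fun x => y ^ (x.1 : ℕ) * z ^ (x.2 : ℕ)
  have hg : Submodule.span k (Set.range g) = ⊤ := by
    rw [eq_top_iff, ← hspan, Submodule.span_le]
    rintro _ ⟨⟨b, c⟩, rfl⟩
    simp only [SetLike.mem_coe]
    by_cases hc : c < h b
    · have hb : b < e := by
        by_contra hb
        have := hanti (not_lt.mp hb)
        omega
      exact Submodule.subset_span ⟨⟨⟨b, hb⟩, ⟨c, hc⟩⟩, rfl⟩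
    · obtain ⟨t, rfl⟩ := Nat.exists_eq_add_of_le (not_lt.mp hc)
      rw [pow_add, ← mul_assoc, hzero, zero_mul]
      exact Submodule.zero_mem _
  refine ⟨⟨⟨(Set.finite_range g).toFinset, by simpa using hg⟩⟩, ?_⟩
  have := finrank_range_le_card (R := k) g
  rw [Set.finrank, hg, finrank_top] at this
  refine this.trans (le_of_eq ?_)
  simp [Finset.sum_range]

lemma aux_bound (e : ℕ) (h : ℕ → ℕ) (hanti : Antitone h) (he : h e = 0) (y z : R)
    (hspan : Submodule.span k (Set.range fun bc : ℕ × ℕ => y ^ bc.1 * z ^ bc.2) = ⊤)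
    (hzero : ∀ b, y ^ b * z ^ (h b) = 0) :
    Module.finrank k (LinearMap.ker ((syzMap e h y z).restrictScalars k))
      ≤ 2 * ∑ i ∈ Finset.range e, h i := by
  obtain ⟨hfin, hR⟩ := aux_finite e h hanti he y z hspan hzero
  set L := syzMap e h y z with hL
  let w : ℕ → Fin e → R := fun i j => if (j : ℕ) = i then 1 else 0
  have hwe : w e = 0 := by
    ext j; simp [w, j.2.ne]
  let N : Submodule R (Fin e → R) := LinearMap.range L
  have hN0 : y • w 0 ∈ N := by
    refine ⟨fun i => if (i : ℕ) = 0 then 1 else 0, ?_⟩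
    ext j; simp only [hL, syzMap, w, LinearMap.coe_mk, AddHom.coe_mk, Fin.val_castSucc, Fin.val_succ, Pi.smul_apply, smul_eq_mul]; simp
  have hNs : ∀ j < e, y • w (j+1) - z ^ (h j - h (j+1)) • w j ∈ N := by
    intro j hj
    refine ⟨fun i => if (i : ℕ) = j + 1 then 1 else 0, ?_⟩
    ext i
    simp only [hL, syzMap, w, LinearMap.coe_mk, AddHom.coe_mk, Fin.val_castSucc, Fin.val_succ,
      Pi.sub_apply, Pi.smul_apply, smul_eq_mul, add_left_inj]
    by_cases hij : (i : ℕ) = j <;> simp [hij]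
  have hNz : ∀ n i, i + n = e → z ^ (h i) • w i ∈ N := by
    intro n
    induction n with
    | zero => intro i hi; obtain rfl : i = e := by omega
              rw [hwe, smul_zero]; exact N.zero_mem
    | succ n ih =>
      intro i hi
      have h1 := N.smul_mem y (ih (i+1) (by omega))
      have h2 := N.smul_mem (z ^ h (i+1)) (hNs i (by omega))
      have h3 := N.sub_mem h1 h2
      convert h3 using 1
      rw [smul_sub, smul_smul, smul_smul, smul_smul, mul_comm y, sub_sub_cancel, ← pow_add]
      congr 2
      have := hanti (Nat.le_succ i)
      simp only [Nat.succ_eq_add_one] at this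
      omega
  let g : (Σ i : Fin e, Fin (h i)) → (Fin e → R) := fun x => z ^ (x.2 : ℕ) • w x.1
  let P : Submodule k (Fin e → R) := Submodule.span k (Set.range g)
  let Q : Submodule k (Fin e → R) := N.restrictScalars k ⊔ P
  have hNQ : ∀ x ∈ N, x ∈ Q := fun x hx => Submodule.mem_sup_left (by simpa using hx)
  have hmon : ∀ b i c, i < e → (y ^ b * z ^ c) • w i ∈ Q := by
    intro b
    induction b with
    | zero =>
      intro i c hi
      rw [pow_zero, one_mul]
      by_cases hc : c < h i
      · exact Submodule.mem_sup_right (Submodule.subset_span ⟨⟨⟨i, hi⟩, ⟨c, hc⟩⟩, rfl⟩)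
      · obtain ⟨t, rfl⟩ := Nat.exists_eq_add_of_le (not_lt.mp hc)
        rw [add_comm, pow_add, mul_smul]
        exact hNQ _ (N.smul_mem _ (hNz (e - i) i (by omega)))
    | succ b ih =>
      intro i c hi
      cases i with
      | zero =>
        have : (y ^ (b+1) * z ^ c) • w 0 = (y ^ b * z ^ c) • (y • w 0) := by
          rw [smul_smul]; congr 1; ring
        rw [this]
        exact hNQ _ (N.smul_mem _ hN0)
      | succ j =>
        have : (y ^ (b+1) * z ^ c) • w (j+1) =
            (y ^ b * z ^ c) • (y • w (j+1) - z ^ (h j - h (j+1)) • w j)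
              + (y ^ b * z ^ (c + (h j - h (j+1)))) • w j := by
          rw [smul_sub, smul_smul, smul_smul, pow_add z c, mul_assoc (y^b) (z^c) (z^_),
            sub_add_cancel]
          congr 1; ring
        rw [this]
        exact Q.add_mem (hNQ _ (N.smul_mem _ (hNs j (by omega)))) (ih j _ (by omega))
  have hQ : Q = ⊤ := by
    have key : ∀ (i : ℕ), i < e → ∀ a : R, a • w i ∈ Q := by
      intro i hi a
      have ha : a ∈ Submodule.span k (Set.range fun bc : ℕ × ℕ => y ^ bc.1 * z ^ bc.2) := by
        rw [hspan]; trivial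
      induction ha using Submodule.span_induction with
      | mem x hx => obtain ⟨⟨b, c⟩, rfl⟩ := hx; exact hmon b i c hi
      | zero => rw [zero_smul]; exact Q.zero_mem
      | add x y _ _ hx hy => rw [add_smul]; exact Q.add_mem hx hy
      | smul t x _ hx => rw [smul_assoc]; exact Q.smul_mem _ hx
    rw [eq_top_iff]
    intro u _
    have : u = ∑ i : Fin e, u i • w i := by
      ext j
      simp [w, Finset.sum_apply, Fin.val_inj]
    rw [this]
    exact Q.sum_mem fun i _ => key i i.2 _
  have hP : Module.finrank k P ≤ ∑ i ∈ Finset.range e, h i := by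
    refine (finrank_range_le_card (R := k) g).trans (le_of_eq ?_)
    simp [Finset.sum_range]
  have h5 := Submodule.finrank_add_le_finrank_add_finrank (N.restrictScalars k) P
  change Module.finrank k Q ≤ _ at h5
  rw [hQ, finrank_top, Module.finrank_pi_fintype] at h5
  have h6 := LinearMap.finrank_range_add_finrank_ker (L.restrictScalars k)
  rw [Module.finrank_pi_fintype] at h6
  have h7 : LinearMap.range (L.restrictScalars k) = N.restrictScalars k := rfl
  rw [h7] at h6
  simp only [Finset.sum_const, Finset.card_univ, Fintype.card_fin, smul_eq_mul] at h5 h6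
  have : (e+1) * Module.finrank k R = e * Module.finrank k R + Module.finrank k R := by ring
  omega
end abstractBound

section concrete

/-- Exponent vector in three variables. -/
noncomputable def mon3 (a b c : ℕ) : Fin 3 →₀ ℕ := Finsupp.equivFunOnFinite.symm ![a, b, c]

/-- Exponent vector in two variables. -/
noncomputable def mon2 (b c : ℕ) : Fin 2 →₀ ℕ := Finsupp.equivFunOnFinite.symm ![b, c]

@[simp] lemma mon3_0 (a b c : ℕ) : mon3 a b c 0 = a := rfl
@[simp] lemma mon3_1 (a b c : ℕ) : mon3 a b c 1 = b := rfl
@[simp] lemma mon3_2 (a b c : ℕ) : mon3 a b c 2 = c := rfl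
@[simp] lemma mon2_0 (b c : ℕ) : mon2 b c 0 = b := rfl
@[simp] lemma mon2_1 (b c : ℕ) : mon2 b c 1 = c := rfl

lemma mon3_ext {μ ν : Fin 3 →₀ ℕ} (h0 : μ 0 = ν 0) (h1 : μ 1 = ν 1) (h2 : μ 2 = ν 2) :
    μ = ν := by
  ext i; fin_cases i <;> assumption

lemma mon2_ext {μ ν : Fin 2 →₀ ℕ} (h0 : μ 0 = ν 0) (h1 : μ 1 = ν 1) : μ = ν := by
  ext i; fin_cases i <;> assumption

lemma mon3_le {μ ν : Fin 3 →₀ ℕ} (h0 : μ 0 ≤ ν 0) (h1 : μ 1 ≤ ν 1) (h2 : μ 2 ≤ ν 2) :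
    μ ≤ ν := by
  intro i; fin_cases i <;> assumption

variable {k : Type*} [Field k]

lemma monomial_mon3 (a b c : ℕ) :
    monomial (mon3 a b c) (1 : k) = X 0 ^ a * X 1 ^ b * X 2 ^ c := by
  rw [monomial_eq, Finsupp.prod_fintype _ _ (by simp), Fin.prod_univ_three]
  simp

lemma monomial_mon2 (b c : ℕ) :
    monomial (mon2 b c) (1 : k) = X 0 ^ b * X 1 ^ c := by
  rw [monomial_eq, Finsupp.prod_fintype _ _ (by simp), Fin.prod_univ_two]
  simp

lemma deg3 (μ : Fin 3 →₀ ℕ) : μ.degree = μ 0 + μ 1 + μ 2 := by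
  rw [Finsupp.degree_eq_sum, Fin.sum_univ_three]

/-- Dehomogenization. -/
noncomputable def dehom (k : Type*) [Field k] :
    MvPolynomial (Fin 3) k →ₐ[k] MvPolynomial (Fin 2) k := aeval ![1, X 0, X 1]

lemma dehom_monomial (μ : Fin 3 →₀ ℕ) (a : k) :
    dehom k (monomial μ a) = monomial (mon2 (μ 1) (μ 2)) a := by
  have : μ = mon3 (μ 0) (μ 1) (μ 2) := mon3_ext rfl rfl rfl
  have h2 : monomial μ a = a • monomial (mon3 (μ 0) (μ 1) (μ 2)) (1:k) := by
    rw [← this, smul_monomial, smul_eq_mul, mul_one]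
  rw [h2, map_smul, monomial_mon3]
  have h3 : monomial (mon2 (μ 1) (μ 2)) a = a • monomial (mon2 (μ 1) (μ 2)) (1:k) := by
    rw [smul_monomial, smul_eq_mul, mul_one]
  rw [h3, monomial_mon2]
  simp [dehom]

lemma coeff_dehom_sum (f : MvPolynomial (Fin 3) k) (ν : Fin 2 →₀ ℕ) :
    coeff ν (dehom k f) =
      ∑ μ ∈ f.support, if mon2 (μ 1) (μ 2) = ν then coeff μ f else 0 := by
  conv_lhs => rw [f.as_sum]
  rw [map_sum, coeff_sum]
  refine Finset.sum_congr rfl fun μ _ => ?_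
  rw [dehom_monomial, coeff_monomial]

lemma coeff_dehom {f : MvPolynomial (Fin 3) k} {n : ℕ} (hf : f.IsHomogeneous n)
    {μ : Fin 3 →₀ ℕ} (hμ : μ ∈ f.support) :
    coeff (mon2 (μ 1) (μ 2)) (dehom k f) = coeff μ f := by
  rw [coeff_dehom_sum, Finset.sum_eq_single μ]
  · simp
  · intro ν hν hne
    rw [if_neg]
    intro heq
    apply hne
    have e1 : ν 1 = μ 1 := by simpa using DFunLike.congr_fun heq 0
    have e2 : ν 2 = μ 2 := by simpa using DFunLike.congr_fun heq 1
    have d1 : ν.degree = n := by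
      by_contra hh; exact (mem_support_iff.mp hν) (hf.coeff_eq_zero hh)
    have d2 : μ.degree = n := by
      by_contra hh; exact (mem_support_iff.mp hμ) (hf.coeff_eq_zero hh)
    rw [deg3] at d1 d2
    exact mon3_ext (by omega) e1 e2
  · intro h; exact absurd hμ h

lemma coeff_dehom_zero {f : MvPolynomial (Fin 3) k} {n : ℕ} (hf : f.IsHomogeneous n)
    {ν : Fin 2 →₀ ℕ} (hν : n < ν 0 + ν 1) :
    coeff ν (dehom k f) = 0 := by
  rw [coeff_dehom_sum]
  refine Finset.sum_eq_zero fun μ hμ => ?_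
  rw [if_neg]
  rintro rfl
  have d2 : μ.degree = n := by
    by_contra hh; exact (mem_support_iff.mp hμ) (hf.coeff_eq_zero hh)
  rw [deg3] at d2
  simp at hν
  omega

/-- Column heights. -/
def hgt (e p m b : ℕ) : ℕ := (e - b) + (if b < m then 1 else 0) + (if b < p then 1 else 0)

lemma hgt_anti (e p m : ℕ) : Antitone (hgt e p m) := by
  intro a b hab
  unfold hgt
  split_ifs <;> omega

/-- The two-variable monomial ideal with column heights `h`. -/
noncomputable def J0 (k : Type*) [Field k] (h : ℕ → ℕ) : Ideal (MvPolynomial (Fin 2) k) :=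
  Ideal.span ((fun μ => monomial μ (1:k)) '' {μ | h (μ 0) ≤ μ 1})

lemma mem_J0 {h : ℕ → ℕ} (hanti : Antitone h) (f : MvPolynomial (Fin 2) k) :
    f ∈ J0 k h ↔ ∀ μ ∈ f.support, h (μ 0) ≤ μ 1 := by
  rw [J0, mem_ideal_span_monomial_image]
  constructor
  · intro H μ hμ
    obtain ⟨ν, hν, hle⟩ := H μ hμ
    exact (hanti (hle 0)).trans (le_trans hν (hle 1))
  · intro H μ hμ
    exact ⟨μ, H μ hμ, le_rfl⟩

lemma monomial_mem_J0 {h : ℕ → ℕ} {b c : ℕ} (hbc : h b ≤ c) :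
    monomial (mon2 b c) (1:k) ∈ J0 k h :=
  Ideal.subset_span ⟨_, hbc, rfl⟩

/-- Exponents of the ideal `I`. -/
def Eset (e p m : ℕ) : Set (Fin 3 →₀ ℕ) :=
  {μ | hgt e p m (μ 1) ≤ μ 2 ∧ ¬ (μ 0 = 0 ∧ p ≤ μ 1 ∧ μ 1 < p + m ∧ μ 1 + μ 2 = e)}

lemma mem_Eset_mon3 {e p m a b c : ℕ} : mon3 a b c ∈ Eset e p m ↔
    (hgt e p m b ≤ c ∧ ¬ (a = 0 ∧ p ≤ b ∧ b < p + m ∧ b + c = e)) := Iff.rfl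

lemma Eset_up {e p m : ℕ} (hm : 0 < m) (hmp : m ≤ p) (hq : p + m ≤ e)
    {μ ν : Fin 3 →₀ ℕ} (hμ : μ ∈ Eset e p m) (hle : μ ≤ ν) :
    ν ∈ Eset e p m := by
  have h0 := hle 0
  have h1 := hle 1
  have h2 := hle 2
  simp only [Eset, Set.mem_ofPred_eq, hgt] at *
  split_ifs at * <;> omega

lemma If_eq {e d r s : ℕ} (h1 : s < d) (h2 : d < r) (h3 : r - s ≤ e) (h4 : r - d ≤ d - s) :
    If k e d r s =
      Ideal.span ((fun μ => monomial μ (1:k)) '' Eset e (d-s) (r-d)) := by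
  apply le_antisymm
  · rw [If, Ideal.span_le]
    have key : ∀ a b c (f : MvPolynomial (Fin 3) k), f = X 0 ^ a * X 1 ^ b * X 2 ^ c →
        mon3 a b c ∈ Eset e (d-s) (r-d) →
        f ∈ Ideal.span ((fun μ => monomial μ (1:k)) '' Eset e (d-s) (r-d)) := by
      rintro a b c f rfl h
      exact Ideal.subset_span ⟨_, h, monomial_mon3 a b c⟩
    rintro _ ((((⟨i, hi, rfl⟩ | ⟨i, hi, rfl⟩) | ⟨i, hi, rfl⟩) | ⟨i, hi, rfl⟩) | ⟨i, hi, rfl⟩)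
    · refine key 0 i (e - i) _ (by simp [A]) ?_
      simp only [Set.mem_Icc] at hi
      rw [mem_Eset_mon3, hgt]
      split_ifs <;> omega
    · refine key 0 i (e - i + 1) _ (by simp [A]; ring) ?_
      simp only [Set.mem_Icc] at hi
      rw [mem_Eset_mon3, hgt]
      split_ifs <;> omega
    · refine key 1 i (e - i) _ (by simp [A]; ring) ?_
      simp only [Set.mem_Icc] at hi
      rw [mem_Eset_mon3, hgt]
      refine ⟨?_, fun hc => one_ne_zero hc.1⟩
      split_ifs <;> omega
    · refine key 0 i (e + 1 - i) _ (by simp [B]) ?_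
      simp only [Set.mem_Icc] at hi
      rw [mem_Eset_mon3, hgt]
      split_ifs <;> omega
    · refine key 0 i (e + 2 - i) _ (by simp [_root_.C]) ?_
      simp only [Set.mem_Iic] at hi
      rw [mem_Eset_mon3, hgt]
      split_ifs <;> omega
  · rw [Ideal.span_le]
    rintro _ ⟨μ, hμ, rfl⟩
    have key : ∀ a b c, X 0 ^ a * X 1 ^ b * X 2 ^ c ∈ If k e d r s → a ≤ μ 0 → b ≤ μ 1 → c ≤ μ 2 →
        monomial μ (1:k) ∈ If k e d r s := by
      intro a b c h ha hb hc
      rw [← monomial_mon3] at h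
      refine Ideal.mem_of_dvd _ ?_ h
      rw [monomial_dvd_monomial]
      exact ⟨Or.inr (mon3_le ha hb hc), dvd_rfl⟩
    simp only [SetLike.mem_coe]
    simp only [Eset, Set.mem_ofPred_eq, hgt] at hμ
    by_cases c1 : μ 1 < r - d
    · refine key 0 (μ 1) (e + 2 - μ 1) ?_ ?_ ?_ ?_
      · refine Ideal.subset_span (Or.inr ⟨μ 1, ?_, by simp [_root_.C]⟩)
        simp only [Set.mem_Iic]; omega
      all_goals (split_ifs at hμ <;> omega)
    by_cases c2 : μ 1 < d - s
    · refine key 0 (μ 1) (e + 1 - μ 1) ?_ ?_ ?_ ?_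
      · refine Ideal.subset_span (Or.inl (Or.inr ⟨μ 1, ?_, by simp [B]⟩))
        simp only [Set.mem_Icc]; omega
      all_goals (split_ifs at hμ <;> omega)
    by_cases c3 : μ 1 < r - s
    · by_cases c4 : μ 0 = 0
      · refine key 0 (μ 1) (e - μ 1 + 1) ?_ ?_ ?_ ?_
        · refine Ideal.subset_span (Or.inl (Or.inl (Or.inl (Or.inr ⟨μ 1, ?_, by simp [A]; ring⟩))))
          simp only [Set.mem_Icc]; omega
        all_goals (split_ifs at hμ <;> omega)
      · refine key 1 (μ 1) (e - μ 1) ?_ ?_ ?_ ?_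
        · refine Ideal.subset_span (Or.inl (Or.inl (Or.inr ⟨μ 1, ?_, by simp [A]; ring⟩)))
          simp only [Set.mem_Icc]; omega
        all_goals (split_ifs at hμ <;> omega)
    by_cases c5 : μ 1 ≤ e
    · refine key 0 (μ 1) (e - μ 1) ?_ ?_ ?_ ?_
      · refine Ideal.subset_span (Or.inl (Or.inl (Or.inl (Or.inl ⟨μ 1, ?_, by simp [A]⟩))))
        simp only [Set.mem_Icc]; omega
      all_goals (split_ifs at hμ <;> omega)
    · refine key 0 e 0 ?_ ?_ ?_ ?_
      · refine Ideal.subset_span (Or.inl (Or.inl (Or.inl (Or.inl ⟨e, ?_, by simp [A]⟩))))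
        simp only [Set.mem_Icc]; omega
      all_goals omega

lemma mem_EI {e p m : ℕ} (hm : 0 < m) (hmp : m ≤ p) (hq : p + m ≤ e)
    (f : MvPolynomial (Fin 3) k) :
    f ∈ Ideal.span ((fun μ => monomial μ (1:k)) '' Eset e p m) ↔
      ∀ μ ∈ f.support, μ ∈ Eset e p m := by
  rw [mem_ideal_span_monomial_image]
  constructor
  · intro H μ hμ
    obtain ⟨ν, hν, hle⟩ := H μ hμ
    exact Eset_up hm hmp hq hν hle
  · intro H μ hμ
    exact ⟨μ, H μ hμ, le_rfl⟩

lemma inj_high {e p m n : ℕ} (hm : 0 < m) (hmp : m ≤ p) (hq : p + m ≤ e) (hn : e < n)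
    {f : MvPolynomial (Fin 3) k} (hf : f.IsHomogeneous n)
    (hd : dehom k f ∈ J0 k (hgt e p m)) :
    f ∈ Ideal.span ((fun μ => monomial μ (1:k)) '' Eset e p m) := by
  rw [mem_EI hm hmp hq]
  intro μ hμ
  rw [mem_J0 (hgt_anti e p m)] at hd
  have h1 := hd (mon2 (μ 1) (μ 2)) (by
    rw [mem_support_iff, coeff_dehom hf hμ]; exact mem_support_iff.mp hμ)
  have d2 : μ.degree = n := by
    by_contra hh; exact (mem_support_iff.mp hμ) (hf.coeff_eq_zero hh)
  rw [deg3] at d2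
  refine ⟨h1, ?_⟩
  omega

/-- Correction polynomial: transports the socle of degree `e` to the socle of degree `e+1`. -/
noncomputable def corr (k : Type*) [Field k] (e p m : ℕ) :
    MvPolynomial (Fin 3) k →ₗ[k] MvPolynomial (Fin 2) k :=
  ∑ i ∈ Finset.range m,
    (lcoeff k (mon3 0 (p+i) (e-p-i))).smulRight (monomial (mon2 i (e+1-i)) (1:k))

lemma corr_apply (e p m : ℕ) (f : MvPolynomial (Fin 3) k) :
    corr k e p m f = ∑ i ∈ Finset.range m,
      coeff (mon3 0 (p+i) (e-p-i)) f • monomial (mon2 i (e+1-i)) (1:k) := by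
  simp [corr, LinearMap.sum_apply]

lemma corr_zero {e p m : ℕ} (hm : 0 < m) (hmp : m ≤ p) (hq : p + m ≤ e)
    {f : MvPolynomial (Fin 3) k}
    (hf : f ∈ Ideal.span ((fun μ => monomial μ (1:k)) '' Eset e p m)) :
    corr k e p m f = 0 := by
  rw [corr_apply]
  refine Finset.sum_eq_zero fun i hi => ?_
  rw [mem_EI hm hmp hq] at hf
  have : coeff (mon3 0 (p+i) (e-p-i)) f = 0 := by
    by_contra hne
    have := hf _ (mem_support_iff.mpr hne)
    rw [mem_Eset_mon3] at this
    have := Finset.mem_range.mp hi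
    omega
  rw [this, zero_smul]

lemma y_corr {e p m : ℕ} (hmp : m ≤ p) (hq : p + m ≤ e) (f : MvPolynomial (Fin 3) k) :
    X 0 * corr k e p m f ∈ J0 k (hgt e p m) := by
  rw [corr_apply, Finset.mul_sum]
  refine Ideal.sum_mem _ fun i hi => ?_
  have := Finset.mem_range.mp hi
  rw [mul_smul_comm]
  refine Submodule.smul_of_tower_mem _ _ ?_
  have h2 : (X 0 : MvPolynomial (Fin 2) k) * monomial (mon2 i (e+1-i)) (1:k)
      = monomial (mon2 (i+1) (e+1-i)) (1:k) := by
    rw [monomial_mon2, monomial_mon2]; ring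
  rw [h2]
  apply monomial_mem_J0
  unfold hgt
  split_ifs <;> omega

lemma z_corr {e p m : ℕ} (hmp : m ≤ p) (hq : p + m ≤ e) (f : MvPolynomial (Fin 3) k) :
    X 1 * corr k e p m f ∈ J0 k (hgt e p m) := by
  rw [corr_apply, Finset.mul_sum]
  refine Ideal.sum_mem _ fun i hi => ?_
  have := Finset.mem_range.mp hi
  rw [mul_smul_comm]
  refine Submodule.smul_of_tower_mem _ _ ?_
  have h2 : (X 1 : MvPolynomial (Fin 2) k) * monomial (mon2 i (e+1-i)) (1:k)
      = monomial (mon2 i (e+1-i+1)) (1:k) := by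
    rw [monomial_mon2, monomial_mon2]; ring
  rw [h2]
  apply monomial_mem_J0
  unfold hgt
  split_ifs <;> omega

lemma inj_low {e p m : ℕ} (hm : 0 < m) (hmp : m ≤ p) (hq : p + m ≤ e)
    {f : MvPolynomial (Fin 3) k} (hf : f.IsHomogeneous e)
    (hd : dehom k f + corr k e p m f ∈ J0 k (hgt e p m)) :
    f ∈ Ideal.span ((fun μ => monomial μ (1:k)) '' Eset e p m) := by
  have hc : ∀ i < m, coeff (mon3 0 (p+i) (e-p-i)) f = 0 := by
    intro i hi
    have h1 : coeff (mon2 i (e+1-i)) (dehom k f + corr k e p m f)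
        = coeff (mon3 0 (p+i) (e-p-i)) f := by
      rw [coeff_add, coeff_dehom_zero hf (by simp; omega), zero_add, corr_apply, coeff_sum,
        Finset.sum_eq_single i]
      · simp
      · intro j _ hj
        rw [coeff_smul, coeff_monomial, if_neg, smul_zero]
        intro h
        exact hj (by simpa using DFunLike.congr_fun h 0)
      · intro h; exact absurd (Finset.mem_range.mpr hi) h
    rw [← h1]
    by_contra hne
    have h2 := (mem_J0 (hgt_anti e p m) _).mp hd _ (mem_support_iff.mpr hne)
    rw [mon2_0, mon2_1, hgt] at h2
    split_ifs at h2 <;> omega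
  have h0 : corr k e p m f = 0 := by
    rw [corr_apply]
    refine Finset.sum_eq_zero fun i hi => ?_
    rw [hc i (Finset.mem_range.mp hi), zero_smul]
  rw [h0, add_zero, mem_J0 (hgt_anti e p m)] at hd
  rw [mem_EI hm hmp hq]
  intro μ hμ
  have h1 := hd (mon2 (μ 1) (μ 2)) (by
    rw [mem_support_iff, coeff_dehom hf hμ]; exact mem_support_iff.mp hμ)
  refine ⟨h1, ?_⟩
  rintro ⟨a0, a1, a2, a3⟩
  apply mem_support_iff.mp hμ
  have := hc (μ 1 - p) (by omega)
  convert this using 2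
  apply mon3_ext <;> simp <;> omega

lemma dehom_EI {e p m : ℕ} {f : MvPolynomial (Fin 3) k}
    (hf : f ∈ Ideal.span ((fun μ => monomial μ (1:k)) '' Eset e p m)) :
    dehom k f ∈ J0 k (hgt e p m) := by
  have : Ideal.span ((fun μ => monomial μ (1:k)) '' Eset e p m) ≤
      (J0 k (hgt e p m)).comap (dehom k) := by
    rw [Ideal.span_le]
    rintro _ ⟨μ, hμ, rfl⟩
    simp only [SetLike.mem_coe, Ideal.mem_comap]
    rw [dehom_monomial]
    exact monomial_mem_J0 hμ.1
  exact this hf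

/-- `x`-exponent of the chosen generators. -/
def epsi (p m i : ℕ) : ℕ := if p ≤ i ∧ i < p + m then 1 else 0

lemma gen_mem {e p m : ℕ} (i : ℕ) :
    mon3 (epsi p m i) i (hgt e p m i) ∈ Eset e p m := by
  rw [mem_Eset_mon3]
  refine ⟨le_rfl, ?_⟩
  rintro ⟨a0, a1, a2, a3⟩
  rw [epsi, if_pos ⟨a1, a2⟩] at a0
  exact one_ne_zero a0

lemma span_mons (h : ℕ → ℕ) :
    Submodule.span k (Set.range fun bc : ℕ × ℕ =>
      (Ideal.Quotient.mk (J0 k h) (X 0)) ^ bc.1 * (Ideal.Quotient.mk (J0 k h) (X 1)) ^ bc.2)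
      = ⊤ := by
  rw [eq_top_iff]
  intro u _
  obtain ⟨f, rfl⟩ := Ideal.Quotient.mk_surjective u
  rw [f.as_sum, map_sum]
  refine Submodule.sum_mem _ fun μ _ => ?_
  have h1 : monomial μ (coeff μ f) = coeff μ f • (X 0 ^ (μ 0) * X 1 ^ (μ 1)) := by
    rw [← monomial_mon2, smul_monomial, smul_eq_mul, mul_one]
    congr 1
    rw [show μ = mon2 (μ 0) (μ 1) from mon2_ext rfl rfl]
    simp
  rw [h1, ← Ideal.Quotient.mkₐ_eq_mk k, map_smul]
  refine Submodule.smul_mem _ _ (Submodule.subset_span ⟨(μ 0, μ 1), ?_⟩)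
  simp

theorem main_bound {e p m : ℕ} (hm : 0 < m) (hmp : m ≤ p) (hq : p + m ≤ e)
    (I : Ideal (MvPolynomial (Fin 3) k))
    (hI : I = Ideal.span ((fun μ => monomial μ (1:k)) '' Eset e p m)) :
    Module.finrank k (Hom0 k I I) ≤ 2 * ∑ i ∈ Finset.range e, hgt e p m i := by
  set h := hgt e p m with hh
  have he : h e = 0 := by
    rw [hh, hgt]; split_ifs <;> omega
  let Rr := MvPolynomial (Fin 2) k ⧸ J0 k h
  let y : Rr := Ideal.Quotient.mk (J0 k h) (X 0)
  let z : Rr := Ideal.Quotient.mk (J0 k h) (X 1)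
  have hspan := span_mons (k := k) h
  have hzero : ∀ b, y ^ b * z ^ (h b) = 0 := by
    intro b
    have := Ideal.Quotient.eq_zero_iff_mem.mpr (monomial_mem_J0 (k := k) (le_refl (h b)))
    rw [monomial_mon2] at this
    simpa [y, z] using this
  have hfin : Module.Finite k Rr := (aux_finite e h (hgt_anti e p m) he y z hspan hzero).1
  have hb := aux_bound e h (hgt_anti e p m) he y z hspan hzero
  refine le_trans ?_ hb
  -- the two maps on the quotient
  let db : (MvPolynomial (Fin 3) k ⧸ I) →ₐ[k] Rr :=
    Ideal.Quotient.liftₐ I ((Ideal.Quotient.mkₐ k (J0 k h)).comp (dehom k)) (by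
      intro f hf
      rw [hI] at hf
      exact Ideal.Quotient.eq_zero_iff_mem.mpr (dehom_EI hf))
  have hdb : ∀ f, db (Ideal.Quotient.mk I f) = Ideal.Quotient.mk (J0 k h) (dehom k f) :=
    fun f => rfl
  let ka : (MvPolynomial (Fin 3) k ⧸ I) →ₗ[k] Rr :=
    ((I.restrictScalars k).liftQ
      ((Ideal.Quotient.mkₐ k (J0 k h)).toLinearMap ∘ₗ corr k e p m) (by
        intro f hf
        have hf' : f ∈ I := hf
        rw [hI] at hf'
        rw [LinearMap.mem_ker, LinearMap.comp_apply, corr_zero hm hmp hq hf', map_zero])) ∘ₗ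
      (Submodule.Quotient.restrictScalarsEquiv k I).symm.toLinearMap
  have hka : ∀ f, ka (Ideal.Quotient.mk I f) = Ideal.Quotient.mk (J0 k h) (corr k e p m f) :=
    fun f => rfl
  have hyka : ∀ u, y * ka u = 0 := by
    intro u
    obtain ⟨f, rfl⟩ := Ideal.Quotient.mk_surjective u
    rw [hka, ← map_mul]
    exact Ideal.Quotient.eq_zero_iff_mem.mpr (y_corr hmp hq f)
  have hzka : ∀ u, z * ka u = 0 := by
    intro u
    obtain ⟨f, rfl⟩ := Ideal.Quotient.mk_surjective u
    rw [hka, ← map_mul]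
    exact Ideal.Quotient.eq_zero_iff_mem.mpr (z_corr hmp hq f)
  have hdbs : ∀ f u, db (f • u) = Ideal.Quotient.mk (J0 k h) (dehom k f) * db u := by
    intro f u
    obtain ⟨g, rfl⟩ := Ideal.Quotient.mk_surjective u
    rw [← hdb, ← map_mul]; rfl
  -- generators
  have hmemI : ∀ μ ∈ Eset e p m, monomial μ (1:k) ∈ I := by
    intro μ hμ; rw [hI]; exact Ideal.subset_span ⟨μ, hμ, rfl⟩
  let G : ℕ → I := fun i =>
    ⟨monomial (mon3 (epsi p m i) i (h i)) (1:k), hmemI _ (gen_mem i)⟩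
  let Phi : Hom0 k I I →ₗ[k] (Fin (e+1) → Rr) :=
    { toFun := fun φ i => db (φ.1 (G i)) + if p + m ≤ (i:ℕ) then ka (φ.1 (G i)) else 0
      map_add' := by
        intro φ ψ; ext i
        simp only [Submodule.coe_add, LinearMap.add_apply, map_add, Pi.add_apply]
        split_ifs
        · abel
        · abel
      map_smul' := by
        intro c φ; ext i
        simp only [Submodule.coe_smul, LinearMap.smul_apply, map_smul, Pi.smul_apply,
          RingHom.id_apply, smul_add]
        split_ifs
        · rfl
        · simp }
  have hPhi : ∀ φ i, Phi φ i =
      db (φ.1 (G i)) + if p + m ≤ (i:ℕ) then ka (φ.1 (G i)) else 0 := fun _ _ => rfl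
  have hker : ∀ φ, Phi φ ∈ LinearMap.ker ((syzMap e h y z).restrictScalars k) := by
    intro φ
    rw [LinearMap.mem_ker]
    ext i
    change y * Phi φ i.castSucc - z ^ (h i - h (i+1)) * Phi φ i.succ = 0
    have ht : ∃ t, h i - h (i+1) = t + 1 := by
      refine ⟨h i - h (i+1) - 1, ?_⟩
      have := i.2
      rw [hh]; unfold hgt
      split_ifs <;> omega
    have hi : h (i+1) ≤ h i := hgt_anti e p m (Nat.le_succ i)
    have e1 : y * Phi φ i.castSucc = y * db (φ.1 (G i)) := by
      rw [hPhi, mul_add, Fin.val_castSucc]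
      split_ifs
      · rw [hyka, add_zero]
      · rw [mul_zero, add_zero]
    have e2 : z ^ (h i - h (i+1)) * Phi φ i.succ
        = z ^ (h i - h (i+1)) * db (φ.1 (G (i+1))) := by
      rw [hPhi, mul_add, Fin.val_succ]
      split_ifs
      · obtain ⟨t, ht⟩ := ht
        rw [ht, pow_succ, mul_assoc (z^t) z (ka _), hzka, mul_zero, add_zero]
      · rw [mul_zero, add_zero]
    rw [e1, e2, sub_eq_zero]
    have rel : (X 0 ^ epsi p m (i+1) * X 1 : MvPolynomial (Fin 3) k) • G i =
        (X 0 ^ epsi p m i * X 2 ^ (h i - h (i+1)) : MvPolynomial (Fin 3) k) • G (i+1) := by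
      apply Subtype.ext
      simp only [G, Submodule.coe_smul, smul_eq_mul, monomial_mon3]
      obtain ⟨t, ht⟩ := Nat.exists_eq_add_of_le hi
      rw [ht, Nat.add_sub_cancel_left]
      ring
    have := congrArg (fun x => db (φ.1 x)) rel
    simp only [map_smul, hdbs] at this
    simpa [dehom, y, z] using this
  have hinj : Function.Injective (Phi.codRestrict _ hker) := by
    rw [injective_iff_map_eq_zero]
    intro φ hφ
    have hφ0 : Phi φ = 0 := congrArg Subtype.val hφ
    have hhom : ∀ a b c (hE : mon3 a b c ∈ Eset e p m),
        ∃ f : MvPolynomial (Fin 3) k, f.IsHomogeneous (a+b+c) ∧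
          φ.1 ⟨monomial (mon3 a b c) 1, hmemI _ hE⟩ = Ideal.Quotient.mk I f := by
      intro a b c hE
      obtain ⟨f, hf, hf2⟩ := φ.2 (a+b+c) ⟨monomial (mon3 a b c) 1, hmemI _ hE⟩
        (isHomogeneous_monomial _ (by rw [deg3]; rfl))
      exact ⟨f, hf, hf2.symm⟩
    have hG : ∀ i ≤ e, φ.1 (G i) = 0 := by
      intro i hi
      have h0 := congrFun hφ0 ⟨i, by omega⟩
      rw [hPhi] at h0
      obtain ⟨f, hf, hf2⟩ := hhom _ _ _ (gen_mem (e := e) (p := p) (m := m) i)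
      change φ.1 (G i) = _ at hf2
      rw [hf2, Ideal.Quotient.eq_zero_iff_mem, hI]
      simp only [hf2, hdb, hka, Pi.zero_apply] at h0
      by_cases c : p + m ≤ i
      · rw [if_pos c, ← map_add, Ideal.Quotient.eq_zero_iff_mem] at h0
        refine inj_low hm hmp hq ?_ h0
        convert hf using 1
        unfold epsi hgt
        split_ifs <;> omega
      · rw [if_neg c, add_zero, Ideal.Quotient.eq_zero_iff_mem] at h0
        refine inj_high hm hmp hq ?_ hf h0
        unfold epsi hgt
        split_ifs <;> omega
    have hall : ∀ μ (hμ : μ ∈ Eset e p m), φ.1 ⟨monomial μ 1, hmemI μ hμ⟩ = 0 := by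
      intro μ hμ
      have dv : ∀ i ≤ e, epsi p m i ≤ μ 0 → i ≤ μ 1 → h i ≤ μ 2 →
          φ.1 ⟨monomial μ 1, hmemI μ hμ⟩ = 0 := by
        intro i hi a0 a1 a2
        have : (⟨monomial μ 1, hmemI μ hμ⟩ : I) =
            (monomial (mon3 (μ 0 - epsi p m i) (μ 1 - i) (μ 2 - h i)) (1:k)) • G i := by
          apply Subtype.ext
          simp only [G, Submodule.coe_smul, smul_eq_mul, monomial_mul, mul_one]
          congr 2
          apply mon3_ext <;> simp <;> omega
        rw [this, map_smul, hG i hi, smul_zero]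
      have hμ1 := hμ.1
      have hμ2 := hμ.2
      by_cases c0 : e < μ 1
      · refine dv e le_rfl ?_ (by omega) (by omega)
        unfold epsi; split_ifs <;> omega
      by_cases c1 : epsi p m (μ 1) ≤ μ 0
      · exact dv (μ 1) (by omega) c1 le_rfl hμ1
      have c2 : p ≤ μ 1 ∧ μ 1 < p + m ∧ μ 0 = 0 := by
        unfold epsi at c1; split_ifs at c1 <;> omega
      -- now the monomial is a multiple of `A_i z`
      have hE : mon3 0 (μ 1) (e - μ 1 + 1) ∈ Eset e p m := by
        rw [mem_Eset_mon3]; unfold hgt; split_ifs <;> omega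
      have hz : φ.1 ⟨monomial (mon3 0 (μ 1) (e - μ 1 + 1)) 1, hmemI _ hE⟩ = 0 := by
        obtain ⟨f, hf, hf2⟩ := hhom _ _ _ hE
        have rel : (X 0 : MvPolynomial (Fin 3) k) •
            (⟨monomial (mon3 0 (μ 1) (e - μ 1 + 1)) 1, hmemI _ hE⟩ : I) =
            (X 2 : MvPolynomial (Fin 3) k) • G (μ 1) := by
          apply Subtype.ext
          have q1 : epsi p m (μ 1) = 1 := by unfold epsi; rw [if_pos]; omega
          have q2 : h (μ 1) = e - μ 1 := by rw [hh]; unfold hgt; split_ifs <;> omega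
          simp only [G, Submodule.coe_smul, smul_eq_mul, monomial_mon3, q1, q2]
          ring
        have r2 := congrArg (fun x => db (φ.1 x)) rel
        simp only [map_smul, hdbs, hG (μ 1) (by omega), hf2, hdb, map_zero, mul_zero] at r2
        have r3 : Ideal.Quotient.mk (J0 k h) (dehom k f) = 0 := by simpa [dehom] using r2
        rw [hf2, Ideal.Quotient.eq_zero_iff_mem, hI]
        refine inj_high hm hmp hq ?_ hf (Ideal.Quotient.eq_zero_iff_mem.mp r3)
        omega
      have q2 : h (μ 1) = e - μ 1 := by rw [hh]; unfold hgt; split_ifs <;> omega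
      have q3 : e - μ 1 + 1 ≤ μ 2 := by
        rw [← hh, q2] at hμ1; omega
      have : (⟨monomial μ 1, hmemI μ hμ⟩ : I) =
          (monomial (mon3 0 0 (μ 2 - (e - μ 1 + 1))) (1:k)) •
            (⟨monomial (mon3 0 (μ 1) (e - μ 1 + 1)) 1, hmemI _ hE⟩ : I) := by
        apply Subtype.ext
        simp only [Submodule.coe_smul, smul_eq_mul, monomial_mul, mul_one]
        congr 2
        apply mon3_ext <;> simp <;> omega
      rw [this, map_smul, hz, smul_zero]
    apply Subtype.ext
    ext x
    obtain ⟨x, hx⟩ := x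
    have hx' := hx
    rw [hI] at hx'
    have hgoal : ∀ hx : x ∈ I, φ.1 ⟨x, hx⟩ = 0 := by
      clear hx
      induction hx' using Submodule.span_induction with
      | mem x hx => obtain ⟨μ, hμ, rfl⟩ := hx; intro _; exact hall μ hμ
      | zero => intro _; exact map_zero φ.1
      | add a b ha hb iha ihb =>
        intro hab
        have ha' : a ∈ I := by rw [hI]; exact ha
        have hb' : b ∈ I := by rw [hI]; exact hb
        have : (⟨a + b, hab⟩ : I) = ⟨a, ha'⟩ + ⟨b, hb'⟩ := rfl
        rw [this, map_add, iha, ihb, add_zero]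
      | smul c a ha iha =>
        intro hca
        have ha' : a ∈ I := by rw [hI]; exact ha
        have : (⟨c • a, hca⟩ : I) = c • ⟨a, ha'⟩ := rfl
        rw [this, map_smul, iha, smul_zero]
    simpa using hgoal hx
  exact LinearMap.finrank_le_finrank_of_injective hinj

lemma sum_hgt {e p m : ℕ} (hq : p + m ≤ e) :
    ∑ i ∈ Finset.range e, hgt e p m i = (e+1).choose 2 + m + p := by
  have aux : ∀ n ≤ e, ∑ i ∈ Finset.range e, (if i < n then 1 else 0) = n := by
    intro n hn
    rw [← Finset.sum_filter, Finset.sum_const, smul_eq_mul, mul_one]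
    rw [show (Finset.range e).filter (fun i => i < n) = Finset.range n by
      ext i; simp; omega, Finset.card_range]
  have aux2 : ∀ n : ℕ, ∑ i ∈ Finset.range n, (n - i) = (n+1).choose 2 := by
    intro n
    induction n with
    | zero => rfl
    | succ n ih =>
      rw [Finset.sum_range_succ', Nat.choose_succ_succ]
      simp only [Nat.add_sub_add_right, ih]
      simp
      omega
  simp only [hgt, Finset.sum_add_distrib]
  rw [aux m (by omega), aux p (by omega), aux2]

end concrete

theorem finrank_hom0_I_le_two_r (k : Type*) [Field k] [IsAlgClosed k]
    (e d r s : ℕ) (hs : s = (e+1).choose 2)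
    (h1 : s < d) (h2 : d < r) (h3 : r < (e+2).choose 2) (h4 : r - d ≤ d - s) :
    Module.finrank k ↥(Hom0 k (If k e d r s) (If k e d r s)) ≤ 2 * r := by
  have hch : (e+2).choose 2 = (e+1) + (e+1).choose 2 := by
    rw [Nat.choose_succ_succ]; simp
  have h5 : r - s ≤ e := by omega
  have h6 := main_bound (k := k) (e := e) (p := d - s) (m := r - d) (by omega) h4 (by omega)
    (If k e d r s) (If_eq h1 h2 h5 h4)
  rw [sum_hgt (by omega)] at h6
  refine h6.trans (le_of_eq ?_)
  omega
end
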